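/- As holomorphic functions on ℍ×ℂ, 12·E_{6,1}(τ,z) = E₆(τ)φ_{0,1}(τ,z) − E₄(τ)²φ_{−2,1}(τ,z). -/

import Mathlib

noncomputable section

open Complex

namespace JacobiPaper

/-- `e2 w = e^{2 π i w}`. -/
def e2 (w : ℂ) : ℂ := Complex.exp (2 * (Real.pi : ℂ) * Complex.I * w)

/-- `q = e^{2 π i τ}`. -/
def qC (τ : ℂ) : ℂ := e2 τ

/-- `ζ = e^{2 π i z}`. -/
def zetaC (z : ℂ) : ℂ := e2 z

/-- The Dedekind eta function `η(τ) = q^{1/24} ∏_{n ≥ 1} (1 - qⁿ)`. -/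
def eta (τ : ℂ) : ℂ :=
  Complex.exp ((Real.pi : ℂ) * Complex.I * τ / 12) * ∏' n : ℕ, (1 - qC τ ^ (n + 1))

/-- The odd Jacobi theta function
`ϑ(τ,z) = q^{1/8} (ζ^{1/2} - ζ^{-1/2}) ∏_{n ≥ 1} (1 - qⁿζ)(1 - qⁿζ⁻¹)(1 - qⁿ)`. -/
def theta (τ z : ℂ) : ℂ :=
  Complex.exp ((Real.pi : ℂ) * Complex.I * τ / 4) *
    (Complex.exp ((Real.pi : ℂ) * Complex.I * z) - Complex.exp (-((Real.pi : ℂ) * Complex.I * z))) *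
    ∏' n : ℕ,
      ((1 - qC τ ^ (n + 1) * zetaC z) * (1 - qC τ ^ (n + 1) * (zetaC z)⁻¹) * (1 - qC τ ^ (n + 1)))

/-- `ϑ₀₀(τ,z) = Σ_{n ∈ ℤ} q^{n²/2} ζⁿ`. -/
def theta00 (τ z : ℂ) : ℂ :=
  ∑' n : ℤ, Complex.exp ((Real.pi : ℂ) * Complex.I * (n : ℂ) ^ 2 * τ +
    2 * (Real.pi : ℂ) * Complex.I * (n : ℂ) * z)

/-- `ϑ₀₁(τ,z) = Σ_{n ∈ ℤ} (-1)ⁿ q^{n²/2} ζⁿ`. -/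
def theta01 (τ z : ℂ) : ℂ :=
  ∑' n : ℤ, (-1 : ℂ) ^ n * Complex.exp ((Real.pi : ℂ) * Complex.I * (n : ℂ) ^ 2 * τ +
    2 * (Real.pi : ℂ) * Complex.I * (n : ℂ) * z)

/-- `ϑ₁₀(τ,z) = q^{1/8} ζ^{1/2} Σ_{n ∈ ℤ} q^{n(n+1)/2} ζⁿ`. -/
def theta10 (τ z : ℂ) : ℂ :=
  Complex.exp ((Real.pi : ℂ) * Complex.I * τ / 4) * Complex.exp ((Real.pi : ℂ) * Complex.I * z) *
    ∑' n : ℤ, Complex.exp ((Real.pi : ℂ) * Complex.I * (n : ℂ) * ((n : ℂ) + 1) * τ +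
      2 * (Real.pi : ℂ) * Complex.I * (n : ℂ) * z)

/-- `ξ₀₀(τ,z) = ϑ₀₀(τ,z)/ϑ₀₀(τ,0)`. -/
def xi00 (τ z : ℂ) : ℂ := theta00 τ z / theta00 τ 0

/-- `ξ₀₁(τ,z) = ϑ₀₁(τ,z)/ϑ₀₁(τ,0)`. -/
def xi01 (τ z : ℂ) : ℂ := theta01 τ z / theta01 τ 0

/-- `ξ₁₀(τ,z) = ϑ₁₀(τ,z)/ϑ₁₀(τ,0)`. -/
def xi10 (τ z : ℂ) : ℂ := theta10 τ z / theta10 τ 0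

/-- The weak Jacobi form `φ_{0,1} = 4(ξ₀₀² + ξ₀₁² + ξ₁₀²)`. -/
def phi01 (τ z : ℂ) : ℂ := 4 * (xi00 τ z ^ 2 + xi01 τ z ^ 2 + xi10 τ z ^ 2)

/-- The weak Jacobi form `φ_{0,2}(τ,z) = 2(ξ₀₀ + ξ₀₁ + ξ₁₀)(τ,2z)`. -/
def phi02 (τ z : ℂ) : ℂ := 2 * (xi00 τ (2 * z) + xi01 τ (2 * z) + xi10 τ (2 * z))

/-- The weak Jacobi form `φ_{0,3}(τ,z) = ϑ(τ,2z)²/ϑ(τ,z)²`. -/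
def phi03 (τ z : ℂ) : ℂ := theta τ (2 * z) ^ 2 / theta τ z ^ 2

/-- The weak Jacobi form `φ_{0,4}(τ,z) = ϑ(τ,3z)/ϑ(τ,z)`. -/
def phi04 (τ z : ℂ) : ℂ := theta τ (3 * z) / theta τ z

/-- The weak Jacobi form `φ_{-2,1}(τ,z) = ϑ(τ,z)²/η(τ)⁶`. -/
def phiM21 (τ z : ℂ) : ℂ := theta τ z ^ 2 / eta τ ^ 6

/-- The divisor power sum `σ_k(n)`. -/
def sigma' (k n : ℕ) : ℕ := ∑ d ∈ n.divisors, d ^ k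

/-- The normalized Eisenstein series `E_k(τ) = 1 - (2k/B_k) Σ_{n ≥ 1} σ_{k-1}(n) qⁿ`. -/
def Eis (k : ℕ) (τ : ℂ) : ℂ :=
  1 - (2 * (k : ℂ) / ((bernoulli k : ℚ) : ℂ)) *
    ∑' n : ℕ, (sigma' (k - 1) (n + 1) : ℂ) * qC τ ^ (n + 1)

/-- The discriminant cusp form `Δ = η²⁴`. -/
def Delta (τ : ℂ) : ℂ := eta τ ^ 24

/-- The modular invariant `j = E₄³/Δ`. -/
def jInv (τ : ℂ) : ℂ := Eis 4 τ ^ 3 / Delta τ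

/-- A choice of `(a, b)` with `a d - b c = 1` completing a coprime pair `(c, d)` to a matrix
`(a b; c d) ∈ SL₂(ℤ)`. -/
def bezout (c d : ℤ) : ℤ × ℤ :=
  haveI : Decidable (∃ ab : ℤ × ℤ, ab.1 * d - ab.2 * c = 1) := Classical.propDecidable _
  if h : ∃ ab : ℤ × ℤ, ab.1 * d - ab.2 * c = 1 then h.choose else 0

/-- The summand `(cτ+d)^{-k} Σ_{l ∈ ℤ} e^{2πim(l²(aτ+b)/(cτ+d) + 2lz/(cτ+d) - cz²/(cτ+d))}`
of the Jacobi–Eisenstein series attached to a coprime pair `(c,d)`; it does not depend on the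
choice of `(a,b)` completing `(c,d)` to an element of `SL₂(ℤ)`. -/
def EisJSummand (k m : ℕ) (τ z : ℂ) (c d : ℤ) : ℂ :=
  ((c : ℂ) * τ + (d : ℂ)) ^ (-(k : ℤ)) *
    ∑' l : ℤ, e2 ((m : ℂ) * ((l : ℂ) ^ 2 * (((bezout c d).1 : ℂ) * τ + ((bezout c d).2 : ℂ)) /
        ((c : ℂ) * τ + (d : ℂ)) +
      2 * (l : ℂ) * z / ((c : ℂ) * τ + (d : ℂ)) - (c : ℂ) * z ^ 2 / ((c : ℂ) * τ + (d : ℂ))))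

/-- The Jacobi–Eisenstein series `E_{k,m}` of weight `k` and index `m`. -/
def EisJ (k m : ℕ) (τ z : ℂ) : ℂ :=
  (1 / 2) * ∑' p : {p : ℤ × ℤ // IsCoprime p.1 p.2}, EisJSummand k m τ z p.1.1 p.1.2

/-- `F_{6,3} = (1/2)(E_{6,1} φ_{0,2} - E₆ φ_{0,3})`. -/
def F63 (τ z : ℂ) : ℂ := (1 / 2) * (EisJ 6 1 τ z * phi02 τ z - Eis 6 τ * phi03 τ z)

/-- A weak Jacobi form of weight `k ∈ ℤ` and index `m ∈ ℕ`: a holomorphic function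
`φ : ℍ × ℂ → ℂ` satisfying the two Jacobi transformation laws and having a Fourier expansion
`φ(τ,z) = Σ_{n ≥ 0, l ∈ ℤ} f(n,l) qⁿ ζˡ`. -/
def IsWeakJacobiForm (k : ℤ) (m : ℕ) (φ : ℂ → ℂ → ℂ) (f : ℕ → ℤ → ℂ) : Prop :=
  DifferentiableOn ℂ (fun p : ℂ × ℂ => φ p.1 p.2) {p : ℂ × ℂ | 0 < p.1.im} ∧
  (∀ a b c d : ℤ, a * d - b * c = 1 → ∀ τ z : ℂ, 0 < τ.im →
    φ (((a : ℂ) * τ + (b : ℂ)) / ((c : ℂ) * τ + (d : ℂ))) (z / ((c : ℂ) * τ + (d : ℂ))) =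
      ((c : ℂ) * τ + (d : ℂ)) ^ k *
        e2 ((m : ℂ) * ((c : ℂ) * z ^ 2 / ((c : ℂ) * τ + (d : ℂ)))) * φ τ z) ∧
  (∀ x y : ℤ, ∀ τ z : ℂ, 0 < τ.im →
    φ τ (z + (x : ℂ) * τ + (y : ℂ)) =
      e2 (-(m : ℂ) * ((x : ℂ) ^ 2 * τ + 2 * (x : ℂ) * z)) * φ τ z) ∧
  (∀ τ z : ℂ, 0 < τ.im →
    HasSum (fun p : ℕ × ℤ => f p.1 p.2 * e2 ((p.1 : ℂ) * τ + (p.2 : ℂ) * z)) (φ τ z))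

/-- A weakly holomorphic Jacobi form of weight `0` and index `m ∈ ℕ`: as a weak Jacobi form,
but the Fourier expansion `φ(τ,z) = Σ_{n ≥ n₀, l ∈ ℤ} f(n,l) qⁿ ζˡ` may contain finitely many
negative powers of `q`. -/
def IsWeaklyHolomorphicJacobiForm0 (m : ℕ) (φ : ℂ → ℂ → ℂ) (f : ℤ → ℤ → ℂ) : Prop :=
  DifferentiableOn ℂ (fun p : ℂ × ℂ => φ p.1 p.2) {p : ℂ × ℂ | 0 < p.1.im} ∧
  (∀ a b c d : ℤ, a * d - b * c = 1 → ∀ τ z : ℂ, 0 < τ.im →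
    φ (((a : ℂ) * τ + (b : ℂ)) / ((c : ℂ) * τ + (d : ℂ))) (z / ((c : ℂ) * τ + (d : ℂ))) =
      e2 ((m : ℂ) * ((c : ℂ) * z ^ 2 / ((c : ℂ) * τ + (d : ℂ)))) * φ τ z) ∧
  (∀ x y : ℤ, ∀ τ z : ℂ, 0 < τ.im →
    φ τ (z + (x : ℂ) * τ + (y : ℂ)) =
      e2 (-(m : ℂ) * ((x : ℂ) ^ 2 * τ + 2 * (x : ℂ) * z)) * φ τ z) ∧
  (∃ n₀ : ℤ, ∀ n : ℤ, n < n₀ → ∀ l : ℤ, f n l = 0) ∧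
  (∀ τ z : ℂ, 0 < τ.im →
    HasSum (fun p : ℤ × ℤ => f p.1 p.2 * e2 ((p.1 : ℂ) * τ + (p.2 : ℂ) * z)) (φ τ z))

/-- A function `φ` on `ℍ × ℂ` has integral Fourier coefficients if it is the sum of a Fourier
series `Σ_{n ≥ 0, l ∈ ℤ} f(n,l) qⁿ ζˡ` with all `f(n,l) ∈ ℤ`. -/
def HasIntegralFourierExpansion (φ : ℂ → ℂ → ℂ) : Prop :=
  ∃ f : ℕ → ℤ → ℤ, ∀ τ z : ℂ, 0 < τ.im →
    HasSum (fun p : ℕ × ℤ => (f p.1 p.2 : ℂ) * e2 ((p.1 : ℂ) * τ + (p.2 : ℂ) * z)) (φ τ z)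

section

open Filter Topology

/-! ### The exponential `e2` -/

lemma e2_add (x y : ℂ) : e2 (x + y) = e2 x * e2 y := by
  simp only [e2, mul_add, Complex.exp_add]

@[simp] lemma e2_zero : e2 0 = 1 := by simp [e2]

lemma e2_ne_zero (x : ℂ) : e2 x ≠ 0 := Complex.exp_ne_zero _

lemma e2_neg (x : ℂ) : e2 (-x) = (e2 x)⁻¹ := by
  simp only [e2, mul_neg, Complex.exp_neg]

@[simp] lemma e2_intCast (n : ℤ) : e2 n = 1 := by
  rw [e2, mul_comm]; exact Complex.exp_int_mul_two_pi_mul_I n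

@[simp] lemma e2_one : e2 1 = 1 := by simpa using e2_intCast 1

lemma e2_eq_one_iff {x : ℂ} : e2 x = 1 ↔ ∃ n : ℤ, x = n := by
  rw [e2, Complex.exp_eq_one_iff]
  refine exists_congr fun n ↦ ⟨fun h ↦ ?_, fun h ↦ by rw [h]; ring⟩
  exact mul_left_cancel₀ two_pi_I_ne_zero (h.trans (mul_comm _ _))

lemma norm_e2 (x : ℂ) : ‖e2 x‖ = Real.exp (-(2 * Real.pi * x.im)) := by
  rw [e2, Complex.norm_exp]
  simp

lemma norm_qC_lt_one {τ : ℂ} (hτ : 0 < τ.im) : ‖qC τ‖ < 1 := by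
  rw [qC, norm_e2, Real.exp_lt_one_iff, neg_lt_zero]
  positivity

@[fun_prop] lemma differentiable_e2 : Differentiable ℂ e2 := by
  unfold e2; fun_prop

/-! ### The product `∏ (1 - q ^ (n + 1) x)` -/

/-- The infinite product `∏_{n ≥ 1} (1 - qⁿ x)`. -/
def qPoch (q x : ℂ) : ℂ := ∏' n : ℕ, (1 - q ^ (n + 1) * x)

lemma summable_pow_succ {q : ℂ} (hq : ‖q‖ < 1) : Summable fun n : ℕ ↦ ‖q‖ ^ (n + 1) :=
  (summable_nat_add_iff 1).mpr (summable_geometric_of_lt_one (norm_nonneg _) hq)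

lemma multipliable_qPoch {q : ℂ} (hq : ‖q‖ < 1) (x : ℂ) :
    Multipliable fun n : ℕ ↦ (1 - q ^ (n + 1) * x) := by
  simp_rw [sub_eq_add_neg]
  apply multipliable_one_add_of_summable
  simpa using (summable_pow_succ hq).mul_right ‖x‖

lemma qPoch_eq {q : ℂ} (hq : ‖q‖ < 1) (x : ℂ) :
    qPoch q x = (1 - q * x) * qPoch q (q * x) := by
  have h := (multipliable_qPoch hq (q * x))
  have : ∀ n : ℕ, 1 - q ^ (n + 1) * (q * x) = 1 - q ^ (n + 1 + 1) * x := fun n ↦ by ring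
  simp_rw [this] at h
  rw [qPoch, tprod_eq_zero_mul' (f := fun n : ℕ ↦ 1 - q ^ (n + 1) * x) h, qPoch]
  simp_rw [this]
  simp

lemma qPoch_ne_zero {q : ℂ} (hq : ‖q‖ < 1) {x : ℂ} (hx : ∀ n : ℕ, q ^ (n + 1) * x ≠ 1) :
    qPoch q x ≠ 0 := by
  have := tprod_one_add_ne_zero_of_summable (f := fun n : ℕ ↦ -(q ^ (n + 1) * x))
    (fun n ↦ by rw [← sub_eq_add_neg]; exact sub_ne_zero.mpr (hx n).symm)
    (by simpa using (summable_pow_succ hq).mul_right ‖x‖)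
  simpa only [qPoch, ← sub_eq_add_neg] using this

lemma differentiable_qPoch {q : ℂ} (hq : ‖q‖ < 1) : Differentiable ℂ (qPoch q) := by
  have key : HasProdLocallyUniformlyOn (fun (n : ℕ) (x : ℂ) ↦ 1 + -(q ^ (n + 1) * x))
      (fun x ↦ ∏' n : ℕ, (1 + -(q ^ (n + 1) * x))) Set.univ := by
    apply hasProdLocallyUniformlyOn_of_forall_compact isOpen_univ
    intro K _ hK
    obtain ⟨C, hC⟩ := hK.isBounded.exists_norm_le
    refine ((summable_pow_succ hq).mul_right C).hasProdUniformlyOn_nat_one_add hK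
      (.of_forall fun n x hx ↦ ?_) (fun _ ↦ by fun_prop)
    rw [norm_neg, norm_mul, norm_pow]
    gcongr
    exact hC x hx
  have := key.differentiableOn (.of_forall fun _ ↦ by
    simpa [Finset.prod_fn] using DifferentiableOn.finsetProd (fun _ _ ↦ by fun_prop)) isOpen_univ
  rw [differentiableOn_univ] at this
  simp only [← sub_eq_add_neg] at this
  exact this

lemma qPoch_one_mul_qPoch_neg_one {q : ℂ} (hq : ‖q‖ < 1) :
    qPoch q 1 * qPoch q (-1) = qPoch (q ^ 2) 1 := by
  rw [qPoch, qPoch, ← (multipliable_qPoch hq _).tprod_mul (multipliable_qPoch hq _), qPoch]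
  exact tprod_congr fun n ↦ by ring

/-! ### The function `φ_{-2,1}` -/

section phiM21

variable {τ : ℂ}

lemma qPoch_one_ne_zero (hτ : 0 < τ.im) : qPoch (qC τ) 1 ≠ 0 := by
  refine qPoch_ne_zero (norm_qC_lt_one hτ) fun n h ↦ ?_
  have := congrArg norm h
  rw [mul_one, norm_pow, norm_one] at this
  exact (pow_lt_one₀ (norm_nonneg _) (norm_qC_lt_one hτ) n.succ_ne_zero).ne this

lemma phiM21_eq (hτ : 0 < τ.im) (z : ℂ) :
    phiM21 τ z = (Complex.exp (Real.pi * I * z) - Complex.exp (-(Real.pi * I * z))) ^ 2 *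
      (qPoch (qC τ) (zetaC z) * qPoch (qC τ) (zetaC z)⁻¹) ^ 2 / qPoch (qC τ) 1 ^ 4 := by
  have hq := norm_qC_lt_one hτ
  have h1 : (∏' n : ℕ, ((1 - qC τ ^ (n + 1) * zetaC z) * (1 - qC τ ^ (n + 1) * (zetaC z)⁻¹) *
      (1 - qC τ ^ (n + 1)))) =
      qPoch (qC τ) (zetaC z) * qPoch (qC τ) (zetaC z)⁻¹ * qPoch (qC τ) 1 := by
    have h3 := multipliable_qPoch hq 1
    rw [qPoch, qPoch, qPoch, ← (multipliable_qPoch hq _).tprod_mul (multipliable_qPoch hq _),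
      ← ((multipliable_qPoch hq _).mul (multipliable_qPoch hq _)).tprod_mul h3]
    simp only [mul_one]
  have h2 : (∏' n : ℕ, (1 - qC τ ^ (n + 1))) = qPoch (qC τ) 1 := by simp [qPoch]
  have h3 : Complex.exp (Real.pi * I * τ / 4) ^ 2 = Complex.exp (Real.pi * I * τ / 12) ^ 6 := by
    rw [← Complex.exp_nat_mul, ← Complex.exp_nat_mul]
    congr 1
    push_cast
    ring
  have h0 := qPoch_one_ne_zero hτ
  have h4 := Complex.exp_ne_zero (Real.pi * I * τ / 12)
  rw [phiM21, theta, eta, h1, h2, div_eq_div_iff (by positivity) (by positivity)]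
  simp only [mul_pow, h3]
  ring

lemma differentiable_phiM21 (hτ : 0 < τ.im) : Differentiable ℂ (phiM21 τ) := by
  have hd := differentiable_qPoch (norm_qC_lt_one hτ)
  have h1 : Differentiable ℂ fun z ↦ qPoch (qC τ) (zetaC z) := hd.comp (by unfold zetaC; fun_prop)
  have h2 : Differentiable ℂ fun z ↦ qPoch (qC τ) (zetaC z)⁻¹ :=
    hd.comp (by simp_rw [zetaC, ← e2_neg]; fun_prop)
  simp_rw [funext (phiM21_eq hτ)]
  fun_prop

lemma phiM21_neg (hτ : 0 < τ.im) (z : ℂ) : phiM21 τ (-z) = phiM21 τ z := by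
  rw [phiM21_eq hτ, phiM21_eq hτ]
  simp only [zetaC, e2_neg, mul_neg, neg_neg, inv_inv]
  ring

lemma phiM21_add_one (hτ : 0 < τ.im) (z : ℂ) : phiM21 τ (z + 1) = phiM21 τ z := by
  rw [phiM21_eq hτ, phiM21_eq hτ]
  simp only [zetaC, e2_add, e2_one, mul_one, mul_add, neg_add, Complex.exp_add, Complex.exp_pi_mul_I,
    Complex.exp_neg (Real.pi * I)]
  ring

lemma phiM21_add_tau (hτ : 0 < τ.im) (z : ℂ) :
    phiM21 τ (z + τ) = e2 (-τ - 2 * z) * phiM21 τ z := by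
  have hq := norm_qC_lt_one hτ
  rw [phiM21_eq hτ, phiM21_eq hτ, mul_div_assoc']
  congr 1
  set w := Complex.exp (Real.pi * I * z) with hw
  set u := Complex.exp (Real.pi * I * τ) with hu
  have hw0 : w ≠ 0 := Complex.exp_ne_zero _
  have hu0 : u ≠ 0 := Complex.exp_ne_zero _
  have hζ : zetaC z = w ^ 2 := by
    rw [zetaC, e2, hw, ← Complex.exp_nat_mul]; congr 1; push_cast; ring
  have hqu : qC τ = u ^ 2 := by
    rw [qC, e2, hu, ← Complex.exp_nat_mul]; congr 1; push_cast; ring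
  have hzτ : zetaC (z + τ) = qC τ * zetaC z := by
    rw [zetaC, e2_add, mul_comm]; rfl
  have he : e2 (-τ - 2 * z) = (u * w ^ 2)⁻¹ ^ 2 := by
    rw [sub_eq_add_neg, e2_add, e2_neg, e2_neg, two_mul, e2_add]
    change (qC τ)⁻¹ * (zetaC z * zetaC z)⁻¹ = _
    rw [hζ, hqu]; field_simp
  have h1 := qPoch_eq hq (zetaC z)
  have h2 := qPoch_eq hq (qC τ * zetaC z)⁻¹
  rw [hzτ, he, mul_add, Complex.exp_neg, Complex.exp_neg, Complex.exp_add, ← hw, ← hu]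
  have h3 : qC τ * (qC τ * zetaC z)⁻¹ = (zetaC z)⁻¹ := by
    rw [hqu, hζ]; field_simp
  rw [h3] at h2
  rw [h1, h2, hqu, hζ]
  field_simp
  ring

/-- `φ_{-2,1}(τ,·)` has no zeros outside of the lattice `ℤτ + ℤ`. -/
lemma phiM21_ne_zero (hτ : 0 < τ.im) {z : ℂ} (hz : ∀ m n : ℤ, z ≠ m * τ + n) :
    phiM21 τ z ≠ 0 := by
  have hq := norm_qC_lt_one hτ
  have hpow : ∀ n : ℕ, qC τ ^ n = e2 (n * τ) := fun n ↦ by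
    rw [qC, e2, e2, ← Complex.exp_nat_mul]; congr 1; ring
  rw [phiM21_eq hτ]
  refine div_ne_zero (mul_ne_zero (pow_ne_zero _ ?_) (pow_ne_zero _ (mul_ne_zero ?_ ?_)))
    (pow_ne_zero _ (qPoch_one_ne_zero hτ))
  · intro h
    have h1 : e2 z = 1 := by
      rw [sub_eq_zero] at h
      rw [e2, show 2 * (Real.pi : ℂ) * I * z = Real.pi * I * z + Real.pi * I * z by ring,
        Complex.exp_add]
      nth_rewrite 1 [h]
      rw [← Complex.exp_add]; simp
    obtain ⟨n, hn⟩ := e2_eq_one_iff.mp h1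
    exact hz 0 n (by simp [hn])
  · refine qPoch_ne_zero hq fun n h ↦ ?_
    rw [hpow, zetaC, ← e2_add] at h
    obtain ⟨m, hm⟩ := e2_eq_one_iff.mp h
    refine hz (-(n + 1 : ℕ)) m ?_
    rw [← hm]; push_cast; ring
  · refine qPoch_ne_zero hq fun n h ↦ ?_
    rw [hpow, zetaC, ← e2_neg, ← e2_add] at h
    obtain ⟨m, hm⟩ := e2_eq_one_iff.mp h
    refine hz (n + 1 : ℕ) (-m) ?_
    push_cast at hm ⊢
    rw [← hm]; ring

lemma phiM21_zero (hτ : 0 < τ.im) : phiM21 τ 0 = 0 := by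
  simp [phiM21_eq hτ]

lemma tendsto_phiM21_div_sq (hτ : 0 < τ.im) :
    Tendsto (fun z ↦ phiM21 τ z / z ^ 2) (𝓝[≠] 0) (𝓝 ((2 * Real.pi * I) ^ 2)) := by
  have hd := differentiable_qPoch (norm_qC_lt_one hτ)
  have h1 : Differentiable ℂ fun z ↦ qPoch (qC τ) (zetaC z) := hd.comp (by unfold zetaC; fun_prop)
  have h2 : Differentiable ℂ fun z ↦ qPoch (qC τ) (zetaC z)⁻¹ :=
    hd.comp (by simp_rw [zetaC, ← e2_neg]; fun_prop)
  have h3 : HasDerivAt (fun z : ℂ ↦ Complex.exp (Real.pi * I * z) - Complex.exp (-(Real.pi * I * z)))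
      (2 * Real.pi * I) 0 := by
    have ha : HasDerivAt (fun z : ℂ ↦ Real.pi * I * z) (Real.pi * I) 0 := by
      simpa using (hasDerivAt_id (0 : ℂ)).const_mul (Real.pi * I)
    convert! ha.cexp.sub ha.neg.cexp using 1
    simp; ring
  have h4 := h3.tendsto_slope
  have h5 : Tendsto (fun z ↦ (qPoch (qC τ) (zetaC z) * qPoch (qC τ) (zetaC z)⁻¹) ^ 2 /
      qPoch (qC τ) 1 ^ 4) (𝓝[≠] 0) (𝓝 1) := by
    have : Continuous (fun z ↦ (qPoch (qC τ) (zetaC z) * qPoch (qC τ) (zetaC z)⁻¹) ^ 2 /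
      qPoch (qC τ) 1 ^ 4) := by
      have := h1.continuous
      have := h2.continuous
      fun_prop
    convert (this.tendsto 0).mono_left nhdsWithin_le_nhds using 2
    have := qPoch_one_ne_zero hτ
    simp [zetaC]
    field_simp
  refine ((h4.pow 2).mul h5).congr' ?_ |>.trans (by simp)
  refine Eventually.of_forall fun z ↦ ?_
  simp only [slope_def_field, phiM21_eq hτ]
  simp
  ring

lemma phiM21_tau_add_one (hτ : 0 < τ.im) (z : ℂ) : phiM21 (τ + 1) z = phiM21 τ z := by
  rw [phiM21_eq hτ, phiM21_eq (by simpa using hτ)]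
  simp [qC, e2_add]

lemma phiM21_half (hτ : 0 < τ.im) :
    phiM21 τ (1 / 2) = -4 * (qPoch (qC τ ^ 2) 1 / qPoch (qC τ) 1 ^ 2) ^ 4 := by
  have h0 := qPoch_one_ne_zero hτ
  have hz : zetaC (1 / 2) = -1 := by
    rw [zetaC, e2, show 2 * (Real.pi : ℂ) * I * (1 / 2) = Real.pi * I by ring, Complex.exp_pi_mul_I]
  have h1 : Complex.exp (Real.pi * I * (1 / 2)) = I := by
    rw [show (Real.pi : ℂ) * I * (1 / 2) = Real.pi / 2 * I by ring, Complex.exp_pi_div_two_mul_I]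
  have h2 : Complex.exp (-(Real.pi * I * (1 / 2))) = -I := by
    rw [Complex.exp_neg, h1, inv_I]
  rw [phiM21_eq hτ, ← qPoch_one_mul_qPoch_neg_one (norm_qC_lt_one hτ), hz, h1, h2,
    show (-1 : ℂ)⁻¹ = -1 by norm_num, sub_neg_eq_add, ← two_mul, mul_pow, I_sq]
  field_simp
  ring

lemma differentiableOn_qPoch_one :
    DifferentiableOn ℂ (fun q ↦ qPoch q 1) (Metric.ball (0 : ℂ) 1) := by
  simpa [qPoch] using ModularForm.differentiableOn_tprod_one_sub_pow

end phiM21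

/-! ### Even theta functions of index one -/

/-- Even entire functions with the quasi-periodicity of index-one Jacobi forms. -/
structure IsIndexOne (τ : ℂ) (f : ℂ → ℂ) : Prop where
  differentiable : Differentiable ℂ f
  neg (z : ℂ) : f (-z) = f z
  add_one (z : ℂ) : f (z + 1) = f z
  add_tau (z : ℂ) : f (z + τ) = e2 (-τ - 2 * z) * f z

variable {τ : ℂ} {f g : ℂ → ℂ}

lemma IsIndexOne.const_mul (hf : IsIndexOne τ f) (c : ℂ) : IsIndexOne τ fun z ↦ c * f z where
  differentiable := hf.differentiable.const_mul c
  neg z := by rw [hf.neg]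
  add_one z := by rw [hf.add_one]
  add_tau z := by rw [hf.add_tau]; ring

lemma IsIndexOne.add (hf : IsIndexOne τ f) (hg : IsIndexOne τ g) :
    IsIndexOne τ fun z ↦ f z + g z where
  differentiable := hf.differentiable.add hg.differentiable
  neg z := by rw [hf.neg, hg.neg]
  add_one z := by rw [hf.add_one, hg.add_one]
  add_tau z := by rw [hf.add_tau, hg.add_tau]; ring

lemma isIndexOne_phiM21 (hτ : 0 < τ.im) : IsIndexOne τ (phiM21 τ) :=
  ⟨differentiable_phiM21 hτ, phiM21_neg hτ, phiM21_add_one hτ, phiM21_add_tau hτ⟩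

lemma exists_eq_sq_mul_of_even (hf : Differentiable ℂ f) (hneg : ∀ z, f (-z) = f z)
    (h0 : f 0 = 0) : ∃ g : ℂ → ℂ, Differentiable ℂ g ∧ ∀ z, f z = z ^ 2 * g z := by
  have hd {k : ℂ → ℂ} (hk : Differentiable ℂ k) : Differentiable ℂ (dslope k 0) := by
    rw [← differentiableOn_univ] at hk ⊢
    exact (Complex.differentiableOn_dslope univ_mem).mpr hk
  have hs (k : ℂ → ℂ) (hk : k 0 = 0) (z : ℂ) : k z = z * dslope k 0 z := by
    have := sub_smul_dslope k 0 z
    simp only [hk, sub_zero, smul_eq_mul] at this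
    exact this.symm
  have h1 : dslope f 0 0 = 0 := by
    have h2 : deriv (fun z ↦ f (-z)) 0 = -deriv f (-0) := deriv_comp_neg f 0
    simp only [hneg, neg_zero] at h2
    rw [dslope_same]
    exact self_eq_neg.mp h2
  refine ⟨dslope (dslope f 0) 0, hd (hd hf), fun z ↦ ?_⟩
  rw [hs f h0 z, hs _ h1 z]
  ring

lemma exists_lattice_translate (hτ : 0 < τ.im) (z : ℂ) :
    ∃ m n : ℤ, ∃ s ∈ Set.Icc (0 : ℝ) 1, ∃ t ∈ Set.Icc (0 : ℝ) 1,
      z = s * τ + t + m * τ + n := by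
  set a := z.im / τ.im with ha
  set b := z.re - a * τ.re with hb
  refine ⟨⌊a⌋, ⌊b⌋, Int.fract a, ⟨Int.fract_nonneg _, (Int.fract_lt_one _).le⟩, Int.fract b,
    ⟨Int.fract_nonneg _, (Int.fract_lt_one _).le⟩, ?_⟩
  have h1 : z = a * τ + b := by
    apply Complex.ext
    · simp [hb]
    · simp [ha, hτ.ne']
  have hs' : ((Int.fract a : ℝ) : ℂ) + (⌊a⌋ : ℤ) = a := by exact_mod_cast Int.fract_add_floor a
  have ht' : ((Int.fract b : ℝ) : ℂ) + (⌊b⌋ : ℤ) = b := by exact_mod_cast Int.fract_add_floor b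
  rw [h1]
  linear_combination -τ * hs' - ht'

/-- Liouville's theorem for elliptic functions. -/
lemma eq_const_of_doubly_periodic (hτ : 0 < τ.im) (hg : Differentiable ℂ g)
    (hp : ∀ (m n : ℤ) z, g (z + m * τ + n) = g z) (z : ℂ) : g z = g 0 := by
  apply hg.apply_eq_apply_of_bounded
  have hK : IsCompact ((fun p : ℝ × ℝ ↦ g (p.1 * τ + p.2)) '' (Set.Icc 0 1 ×ˢ Set.Icc 0 1)) := by
    apply (isCompact_Icc.prod isCompact_Icc).image
    have := hg.continuous
    fun_prop
  refine hK.isBounded.subset ?_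
  rintro _ ⟨w, rfl⟩
  obtain ⟨m, n, s, hs, t, ht, rfl⟩ := exists_lattice_translate hτ w
  exact ⟨(s, t), ⟨hs, ht⟩, (hp m n _).symm⟩

/-- An index-one function vanishing at the origin is a multiple of `φ_{-2,1}`. -/
lemma IsIndexOne.exists_eq_const_mul_phiM21 (hτ : 0 < τ.im) (hf : IsIndexOne τ f)
    (h0 : f 0 = 0) : ∃ K : ℂ, ∀ z, f z = K * phiM21 τ z := by
  have hφ := isIndexOne_phiM21 hτ
  obtain ⟨u, hu, hφu⟩ := exists_eq_sq_mul_of_even hφ.differentiable hφ.neg (phiM21_zero hτ)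
  have hu0 : u 0 ≠ 0 := by
    have h1 : Tendsto u (𝓝[≠] 0) (𝓝 (u 0)) := (hu.continuous.tendsto 0).mono_left
      nhdsWithin_le_nhds
    have h2 : u 0 = (2 * Real.pi * I) ^ 2 := by
      refine tendsto_nhds_unique h1 ((tendsto_phiM21_div_sq hτ).congr' ?_)
      filter_upwards [self_mem_nhdsWithin] with z hz
      rw [hφu, mul_div_cancel_left₀ _ (pow_ne_zero _ hz)]
    rw [h2]
    exact pow_ne_zero _ two_pi_I_ne_zero
  obtain ⟨v, hv, hfv⟩ := exists_eq_sq_mul_of_even hf.differentiable hf.neg h0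
  set K := v 0 / u 0 with hK
  refine ⟨K, ?_⟩
  have hh : IsIndexOne τ fun z ↦ f z + -K * phiM21 τ z := hf.add (hφ.const_mul (-K))
  set h : ℂ → ℂ := fun z ↦ f z + -K * phiM21 τ z with hhdef
  set w : ℂ → ℂ := fun z ↦ v z + -K * u z with hwdef
  have hw : Differentiable ℂ w := by fun_prop
  have hhw : ∀ z, h z = z ^ 2 * w z := fun z ↦ by
    simp only [hhdef, hwdef, hfv, hφu]; ring
  have hw0 : w 0 = 0 := by simp only [hwdef, hK]; field_simp; ring
  have hquot : (fun z ↦ h z / phiM21 τ z) = fun z ↦ w z / u z := by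
    funext z
    rw [hhw, hφu]
    rcases eq_or_ne z 0 with rfl | hz
    · simp [hw0]
    · rw [mul_div_mul_left _ _ (pow_ne_zero _ hz)]
  have hper1 : Function.Periodic (fun z ↦ h z / phiM21 τ z) 1 := fun z ↦ by
    simp only [hh.add_one, hφ.add_one]
  have hperτ : Function.Periodic (fun z ↦ h z / phiM21 τ z) τ := fun z ↦ by
    simp only [hh.add_tau, hφ.add_tau, mul_div_mul_left _ _ (e2_ne_zero _)]
  have hper : ∀ (m n : ℤ) z, h (z + m * τ + n) / phiM21 τ (z + m * τ + n) = h z / phiM21 τ z :=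
    fun m n z ↦ by
      have h1 := hper1.int_mul n (z + m * τ)
      have h2 := hperτ.int_mul m z
      simp only [mul_one] at h1 h2
      rw [h1, h2]
  have hdiff : Differentiable ℂ fun z ↦ h z / phiM21 τ z := by
    have hloc (z : ℂ) (hz : u z ≠ 0) : DifferentiableAt ℂ (fun z ↦ h z / phiM21 τ z) z := by
      rw [hquot]
      exact (hw z).div (hu z) hz
    intro z
    by_cases hz : ∀ m n : ℤ, z ≠ m * τ + n
    · refine hloc z fun h1 ↦ phiM21_ne_zero hτ hz ?_
      rw [hφu, h1, mul_zero]
    · push Not at hz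
      obtain ⟨m, n, rfl⟩ := hz
      have h1 : DifferentiableAt ℂ (fun z ↦ h z / phiM21 τ z)
          ((m : ℂ) * τ + n + ((-m : ℤ) * τ + (-n : ℤ))) := by
        convert hloc 0 hu0 using 1; push_cast; ring
      have h2 := h1.comp (m * τ + n : ℂ) (f := fun z ↦ z + ((-m : ℤ) * τ + (-n : ℤ))) (by fun_prop)
      refine h2.congr_of_eventuallyEq (Eventually.of_forall fun z ↦ ?_)
      simp only [Function.comp_apply, ← add_assoc, hper]
  have hzero : ∀ z, w z / u z = 0 := fun z ↦ by
    have := (congrFun hquot z).symm.trans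
      ((eq_const_of_doubly_periodic hτ hdiff hper z).trans (congrFun hquot 0))
    simpa [hw0] using this
  have hw_ev : w =ᶠ[𝓝 0] 0 := by
    filter_upwards [hu.continuous.continuousAt.eventually_ne hu0] with z hz
    simpa [hz] using hzero z
  have hw_zero : w = 0 := AnalyticOnNhd.eq_of_eventuallyEq
    (fun z _ ↦ hw.analyticAt z) (fun z _ ↦ analyticAt_const) hw_ev
  intro z
  have := hhw z
  rw [hw_zero] at this
  simp only [hhdef, Pi.zero_apply, mul_zero] at this
  linear_combination this

section transformation

variable {τ : ℂ} {f : ℂ → ℂ}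

lemma IsIndexOne.add_lattice (hf : IsIndexOne τ f) (m n : ℤ) (z : ℂ) :
    f (z + m * τ + n) = e2 (-(m ^ 2 * τ) - 2 * m * z) * f z := by
  have h1 (z : ℂ) : f (z + n) = f z := by
    simpa using (show Function.Periodic f 1 from hf.add_one).int_mul n z
  have h2 (k : ℕ) (z : ℂ) : f (z + k * τ) = e2 (-(k ^ 2 * τ) - 2 * k * z) * f z := by
    induction k with
    | zero => simp
    | succ k ih =>
      rw [show z + (k + 1 : ℕ) * τ = z + k * τ + τ by push_cast; ring, hf.add_tau, ih, ← mul_assoc,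
        ← e2_add]
      congr 2
      push_cast; ring
  rw [h1]
  obtain ⟨k, rfl | rfl⟩ := m.eq_nat_or_neg
  · exact_mod_cast h2 k z
  · rw [← hf.neg, show -(z + ((-k : ℤ) : ℂ) * τ) = -z + k * τ by push_cast; ring, h2, hf.neg]
    congr 2
    push_cast; ring

lemma denom_ne_zero' (hτ : 0 < τ.im) {a b c d : ℤ} (h : a * d - b * c = 1) :
    (c : ℂ) * τ + d ≠ 0 := by
  intro h0
  have him := congrArg Complex.im h0
  have hre := congrArg Complex.re h0
  simp [hτ.ne'] at him
  simp [him] at hre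
  simp [him, hre] at h

lemma im_moebius_pos (hτ : 0 < τ.im) {a b c d : ℤ} (h : a * d - b * c = 1) :
    0 < ((a * τ + b) / (c * τ + d)).im := by
  have h0 := Complex.normSq_pos.mpr (denom_ne_zero' hτ h)
  have h' : (a * d - b * c : ℝ) = 1 := by exact_mod_cast h
  have : ((a * τ + b) / (c * τ + d)).im = τ.im / Complex.normSq (c * τ + d) := by
    rw [Complex.div_im, ← sub_div]
    congr 1
    simp
    linear_combination τ.im * h'
  rw [this]
  positivity

lemma im_neg_one_div_pos (hτ : 0 < τ.im) : 0 < (-1 / τ).im := by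
  simpa using im_moebius_pos hτ (a := 0) (b := -1) (c := 1) (d := 0) (by simp)

/-- The index-one slash action of `SL₂(ℤ)`. -/
lemma IsIndexOne.slash (hτ : 0 < τ.im) {a b c d : ℤ} (h : a * d - b * c = 1)
    (hf : IsIndexOne ((a * τ + b) / (c * τ + d)) f) :
    IsIndexOne τ fun z ↦ e2 (-(c * z ^ 2 / (c * τ + d))) * f (z / (c * τ + d)) := by
  have hj := denom_ne_zero' hτ h
  have h' : (a * d - b * c : ℂ) = 1 := by exact_mod_cast h
  set τ' := (a * τ + b) / (c * τ + d) with hτ'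
  have hτ'j : τ' * (c * τ + d) = a * τ + b := div_mul_cancel₀ _ hj
  set j := (c * τ + d : ℂ) with hjd
  have hd := hf.differentiable
  refine ⟨by fun_prop, fun z ↦ ?_, fun z ↦ ?_, fun z ↦ ?_⟩
  · rw [neg_div, hf.neg, neg_sq]
  · have e1 : (z + 1) / j = z / j + ((-c : ℤ) : ℂ) * τ' + (a : ℤ) := by
      field_simp
      push_cast
      linear_combination c * hτ'j - h' + a * hjd
    rw [e1, hf.add_lattice, ← mul_assoc, ← e2_add]
    have e2' : -(c * (z + 1) ^ 2 / j) + (-(((-c : ℤ) : ℂ) ^ 2 * τ') - 2 * ((-c : ℤ) : ℂ) * (z / j)) =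
        -(c * z ^ 2 / j) + ((-(c * a) : ℤ) : ℂ) := by
      field_simp
      push_cast
      linear_combination -c ^ 2 * hτ'j + c * h' - c * a * hjd
    rw [e2', e2_add, e2_intCast, mul_one]
  · have e1 : (z + τ) / j = z / j + (d : ℂ) * τ' + ((-b : ℤ) : ℂ) := by
      field_simp
      push_cast
      linear_combination -d * hτ'j - τ * h' - b * hjd
    rw [e1, hf.add_lattice, ← mul_assoc, ← mul_assoc, ← e2_add, ← e2_add]
    have e2' : -(c * (z + τ) ^ 2 / j) + (-((d : ℂ) ^ 2 * τ') - 2 * (d : ℂ) * (z / j)) =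
        -τ - 2 * z + -(c * z ^ 2 / j) + ((-(b * d) : ℤ) : ℂ) := by
      field_simp
      push_cast
      linear_combination -d ^ 2 * hτ'j + (2 * z + τ + b * d) * hjd - d * τ * h'
    rw [e2', e2_add, e2_intCast, mul_one]

lemma IsIndexOne.slash_S (hτ : 0 < τ.im) (hf : IsIndexOne (-1 / τ) f) :
    IsIndexOne τ fun z ↦ e2 (-(z ^ 2 / τ)) * f (z / τ) := by
  simpa using IsIndexOne.slash hτ (a := 0) (b := -1) (c := 1) (d := 0) (by simp)
    (f := f) (by simpa using hf)

lemma ne_zero_of_im_pos (hτ : 0 < τ.im) : τ ≠ 0 := by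
  rintro rfl
  simp at hτ

lemma phiM21_S (hτ : 0 < τ.im) (z : ℂ) :
    phiM21 (-1 / τ) (z / τ) = τ ^ (-2 : ℤ) * e2 (z ^ 2 / τ) * phiM21 τ z := by
  have h0 := ne_zero_of_im_pos hτ
  have hτ' := im_neg_one_div_pos hτ
  obtain ⟨K, hK⟩ := (IsIndexOne.slash_S hτ (isIndexOne_phiM21 hτ')).exists_eq_const_mul_phiM21 hτ
    (by simp [phiM21_zero hτ'])
  have hmul : Tendsto (fun z : ℂ ↦ z / τ) (𝓝[≠] 0) (𝓝[≠] 0) := by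
    refine tendsto_nhdsWithin_iff.mpr ⟨?_, ?_⟩
    · have : Continuous fun z : ℂ ↦ z / τ := by fun_prop
      simpa using (this.tendsto 0).mono_left (nhdsWithin_le_nhds (s := {0}ᶜ))
    · filter_upwards [self_mem_nhdsWithin] with z hz
      exact div_ne_zero hz h0
  have h1 := (tendsto_phiM21_div_sq hτ').comp hmul
  have h2 := (tendsto_phiM21_div_sq hτ).const_mul K
  have h3 : Tendsto (fun z : ℂ ↦ e2 (-(z ^ 2 / τ)) / τ ^ 2) (𝓝[≠] 0) (𝓝 (1 / τ ^ 2)) := by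
    have : Continuous fun z : ℂ ↦ e2 (-(z ^ 2 / τ)) / τ ^ 2 := by
      have := differentiable_e2.continuous
      fun_prop
    simpa using (this.tendsto 0).mono_left (nhdsWithin_le_nhds (s := {0}ᶜ))
  have h4 : 1 / τ ^ 2 * (2 * Real.pi * I) ^ 2 = K * (2 * Real.pi * I) ^ 2 := by
    refine tendsto_nhds_unique (h3.mul h1) (h2.congr' ?_)
    filter_upwards [self_mem_nhdsWithin] with z hz
    have hz' : z ≠ 0 := hz
    rw [← mul_div_assoc, ← hK]
    simp only [Function.comp_apply]
    field_simp
  have h5 := mul_right_cancel₀ (pow_ne_zero 2 two_pi_I_ne_zero) h4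
  have h6 := hK z
  rw [← h5, e2_neg] at h6
  have h7 := e2_ne_zero (z ^ 2 / τ)
  rw [zpow_neg]
  field_simp at h6 ⊢
  exact_mod_cast h6

end transformation

section thetas

variable {τ : ℂ} {f : ℂ → ℂ}

lemma exp_pi_mul_I_int_sq (n : ℤ) :
    Complex.exp (Real.pi * I * n ^ 2) = Complex.exp (Real.pi * I * n) := by
  obtain ⟨k, hk⟩ := Int.even_mul_succ_self (n - 1)
  have hk' : ((n : ℂ) - 1) * n = k + k := by
    have := congrArg (Int.cast : ℤ → ℂ) hk
    push_cast at this
    linear_combination this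
  rw [Complex.exp_eq_exp_iff_exists_int]
  exact ⟨k, by linear_combination (Real.pi * I : ℂ) * hk'⟩

lemma theta00_eq (τ z : ℂ) : theta00 τ z = jacobiTheta₂ z τ :=
  tsum_congr fun n ↦ by rw [jacobiTheta₂_term, add_comm]

lemma theta01_eq (τ z : ℂ) : theta01 τ z = jacobiTheta₂ (z + 1 / 2) τ := by
  refine tsum_congr fun n ↦ ?_
  rw [jacobiTheta₂_term, ← Complex.exp_pi_mul_I, ← Complex.exp_int_mul, ← Complex.exp_add]
  ring_nf

lemma theta10_eq (τ z : ℂ) : theta10 τ z =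
    Complex.exp (Real.pi * I * τ / 4 + Real.pi * I * z) * jacobiTheta₂ (z + τ / 2) τ := by
  rw [theta10, Complex.exp_add]
  congr 1
  refine tsum_congr fun n ↦ ?_
  rw [jacobiTheta₂_term]
  ring_nf

lemma jacobiTheta₂_tau_add_one (z τ : ℂ) : jacobiTheta₂ z (τ + 1) = jacobiTheta₂ (z + 1 / 2) τ := by
  refine tsum_congr fun n ↦ ?_
  rw [jacobiTheta₂_term, jacobiTheta₂_term, mul_add (Real.pi * I * n ^ 2 : ℂ), mul_one,
    ← add_assoc, Complex.exp_add, exp_pi_mul_I_int_sq, ← Complex.exp_add]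
  ring_nf

lemma theta00_tau_add_one (τ z : ℂ) : theta00 (τ + 1) z = theta01 τ z := by
  rw [theta00_eq, theta01_eq, jacobiTheta₂_tau_add_one]

lemma theta01_tau_add_one (τ z : ℂ) : theta01 (τ + 1) z = theta00 τ z := by
  rw [theta00_eq, theta01_eq, jacobiTheta₂_tau_add_one, add_assoc, add_halves,
    jacobiTheta₂_add_left]

lemma theta10_tau_add_one (τ z : ℂ) :
    theta10 (τ + 1) z = Complex.exp (Real.pi * I / 4) * theta10 τ z := by
  rw [theta10_eq, theta10_eq, jacobiTheta₂_tau_add_one,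
    show z + (τ + 1) / 2 + 1 / 2 = z + τ / 2 + 1 by ring, jacobiTheta₂_add_left, ← mul_assoc,
    ← Complex.exp_add]
  ring_nf

/-- The automorphy factor of the theta functions under `τ ↦ -1/τ`. -/
def thetaFactor (τ z : ℂ) : ℂ := (-I * τ) ^ (1 / 2 : ℂ) * Complex.exp (Real.pi * I * z ^ 2 / τ)

lemma thetaFactor_ne_zero (hτ : 0 < τ.im) (z : ℂ) : thetaFactor τ z ≠ 0 := by
  refine mul_ne_zero ?_ (Complex.exp_ne_zero _)
  rw [Ne, Complex.cpow_eq_zero_iff]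
  simp [ne_zero_of_im_pos hτ]

lemma thetaFactor_div_sq (hτ : 0 < τ.im) (z : ℂ) :
    (thetaFactor τ z / thetaFactor τ 0) ^ 2 = e2 (z ^ 2 / τ) := by
  have h := thetaFactor_ne_zero hτ 0
  simp only [thetaFactor, ne_eq, mul_eq_zero, not_or] at h
  rw [thetaFactor, thetaFactor, mul_div_mul_left _ _ h.1]
  simp only [ne_eq, OfNat.ofNat_ne_zero, not_false_eq_true, zero_pow, mul_zero, zero_div,
    Complex.exp_zero, div_one]
  rw [← Complex.exp_nat_mul, e2]
  congr 1
  push_cast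
  ring

lemma jacobiTheta₂_S (hτ : 0 < τ.im) (z : ℂ) :
    jacobiTheta₂ (z / τ) (-1 / τ) = thetaFactor τ z * jacobiTheta₂ z τ := by
  have h := thetaFactor_ne_zero hτ 0
  simp only [thetaFactor, ne_eq, mul_eq_zero, not_or] at h
  rw [jacobiTheta₂_functional_equation z τ, thetaFactor, ← mul_assoc]
  have h1 : Complex.exp (-Real.pi * I * z ^ 2 / τ) = (Complex.exp (Real.pi * I * z ^ 2 / τ))⁻¹ := by
    rw [← Complex.exp_neg]; ring_nf
  have h2 := Complex.exp_ne_zero (Real.pi * I * z ^ 2 / τ)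
  have h3 := h.1
  rw [h1]
  generalize (-I * τ) ^ (1 / 2 : ℂ) = s at h3
  field_simp

lemma theta00_S (hτ : 0 < τ.im) (z : ℂ) :
    theta00 (-1 / τ) (z / τ) = thetaFactor τ z * theta00 τ z := by
  rw [theta00_eq, theta00_eq, jacobiTheta₂_S hτ]

lemma theta01_S (hτ : 0 < τ.im) (z : ℂ) :
    theta01 (-1 / τ) (z / τ) = thetaFactor τ z * theta10 τ z := by
  have h0 := ne_zero_of_im_pos hτ
  rw [theta01_eq, theta10_eq, show z / τ + 1 / 2 = (z + τ / 2) / τ by field_simp,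
    jacobiTheta₂_S hτ, thetaFactor, thetaFactor, ← mul_assoc]
  congr 1
  rw [mul_assoc (_ ^ _), ← Complex.exp_add]
  congr 2
  field_simp
  ring

lemma theta10_S (hτ : 0 < τ.im) (z : ℂ) :
    theta10 (-1 / τ) (z / τ) = thetaFactor τ z * theta01 τ z := by
  have h0 := ne_zero_of_im_pos hτ
  rw [theta10_eq, theta01_eq, show z / τ + -1 / τ / 2 = (z - 1 / 2) / τ by field_simp; ring,
    jacobiTheta₂_S hτ, ← jacobiTheta₂_add_left (z - 1 / 2),
    show z - 1 / 2 + 1 = z + 1 / 2 by ring, thetaFactor, thetaFactor, ← mul_assoc]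
  congr 1
  rw [mul_left_comm, ← Complex.exp_add]
  congr 2
  field_simp
  ring

lemma isIndexOne_theta00_sq (hτ : 0 < τ.im) : IsIndexOne τ fun z ↦ theta00 τ z ^ 2 where
  differentiable := by
    simp_rw [theta00_eq]
    exact Differentiable.pow (fun z ↦ differentiableAt_jacobiTheta₂_fst z hτ) 2
  neg z := by simp_rw [theta00_eq, jacobiTheta₂_neg_left]
  add_one z := by simp_rw [theta00_eq, jacobiTheta₂_add_left]
  add_tau z := by
    simp_rw [theta00_eq, jacobiTheta₂_add_left', mul_pow, ← Complex.exp_nat_mul, e2]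
    push_cast
    ring_nf

lemma isIndexOne_theta01_sq (hτ : 0 < τ.im) : IsIndexOne τ fun z ↦ theta01 τ z ^ 2 where
  differentiable := by
    have h : Differentiable ℂ (jacobiTheta₂ · τ) := fun z ↦ differentiableAt_jacobiTheta₂_fst z hτ
    simp_rw [theta01_eq]
    exact (h.comp (differentiable_id.add_const _)).pow 2
  neg z := by
    simp_rw [theta01_eq]
    rw [← jacobiTheta₂_neg_left, ← jacobiTheta₂_add_left]
    ring_nf
  add_one z := by
    simp_rw [theta01_eq, add_right_comm z 1, jacobiTheta₂_add_left]
  add_tau z := by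
    simp_rw [theta01_eq, add_right_comm z τ, jacobiTheta₂_add_left', mul_pow, ← Complex.exp_nat_mul]
    rw [show -τ - 2 * z = -τ - 2 * z - 1 + 1 by ring, e2_add, e2_one, mul_one, e2]
    push_cast
    ring_nf

lemma isIndexOne_theta10_sq (hτ : 0 < τ.im) : IsIndexOne τ fun z ↦ theta10 τ z ^ 2 where
  differentiable := by
    have h : Differentiable ℂ (jacobiTheta₂ · τ) := fun z ↦ differentiableAt_jacobiTheta₂_fst z hτ
    have h' : Differentiable ℂ fun z ↦ jacobiTheta₂ (z + τ / 2) τ :=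
      h.comp (differentiable_id.add_const _)
    simp_rw [theta10_eq]
    fun_prop
  neg z := by
    congr 1
    rw [theta10_eq, theta10_eq, ← jacobiTheta₂_neg_left,
      show z + τ / 2 = -(-z + τ / 2) + τ by ring, jacobiTheta₂_add_left', ← mul_assoc,
      ← Complex.exp_add]
    congr 2
    ring
  add_one z := by
    simp_rw [theta10_eq, add_right_comm z 1, jacobiTheta₂_add_left, mul_add, ← add_assoc]
    rw [Complex.exp_add, mul_one, Complex.exp_pi_mul_I]
    ring
  add_tau z := by
    simp_rw [theta10_eq, add_right_comm z τ, jacobiTheta₂_add_left', mul_pow,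
      ← Complex.exp_nat_mul, e2, ← mul_assoc, ← Complex.exp_add]
    congr 2
    push_cast
    ring

lemma exists_jacobiTheta₂_ne_zero (hτ : 0 < τ.im) : ∃ z, jacobiTheta₂ z τ ≠ 0 := by
  by_contra! h
  have h1 : HasSum (fun n : ℤ ↦ ∫ t in (0 : ℝ)..1, jacobiTheta₂_term n t τ)
      (∫ t in (0 : ℝ)..1, jacobiTheta₂ t τ) := by
    refine intervalIntegral.hasSum_integral_of_dominated_convergence
      (fun n _ ↦ ‖jacobiTheta₂_term n 0 τ‖) (fun n ↦ ?_) (fun n ↦ .of_forall fun t _ ↦ ?_)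
      (.of_forall fun t _ ↦ ((summable_jacobiTheta₂_term_iff 0 τ).mpr hτ).norm)
      intervalIntegrable_const (.of_forall fun t _ ↦ hasSum_jacobiTheta₂_term t hτ)
    · refine Continuous.aestronglyMeasurable ?_
      unfold jacobiTheta₂_term
      fun_prop
    · simp [norm_jacobiTheta₂_term]
  have h2 (n : ℤ) : ∫ t in (0 : ℝ)..1, jacobiTheta₂_term n t τ = if n = 0 then 1 else 0 := by
    split_ifs with hn
    · simp [hn, jacobiTheta₂_term]
    · have h3 : (2 * Real.pi * I * n : ℂ) ≠ 0 :=
        mul_ne_zero two_pi_I_ne_zero (Int.cast_ne_zero.mpr hn)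
      simp_rw [jacobiTheta₂_term, Complex.exp_add]
      rw [intervalIntegral.integral_mul_const, integral_exp_mul_complex h3]
      have h4 : Complex.exp (2 * Real.pi * I * n) = 1 := e2_intCast n
      simp [h4]
  simp_rw [h2, h, intervalIntegral.integral_zero] at h1
  exact one_ne_zero ((hasSum_ite_eq (0 : ℤ) (1 : ℂ)).unique h1)

lemma half_lattice_ne (hτ : 0 < τ.im) {x y : ℤ} (h : Odd x ∨ Odd y) (m n : ℤ) :
    (x * τ + y) / 2 ≠ m * τ + n := by
  intro he
  have him := congrArg Complex.im he
  have hre := congrArg Complex.re he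
  have hx : (x : ℝ) = 2 * m := by
    simp at him
    exact mul_right_cancel₀ hτ.ne' (by linarith)
  have hy : (y : ℝ) = 2 * n := by
    simp [hx] at hre
    linarith
  have hx' : x = 2 * m := by exact_mod_cast hx
  have hy' : y = 2 * n := by exact_mod_cast hy
  rcases h with ⟨k, hk⟩ | ⟨k, hk⟩ <;> omega

lemma IsIndexOne.eq_zero (hτ : 0 < τ.im) (hf : IsIndexOne τ f) (h0 : f 0 = 0) {x y : ℤ}
    (hxy : Odd x ∨ Odd y) (h : f ((x * τ + y) / 2) = 0) (z : ℂ) : f z = 0 := by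
  obtain ⟨K, hK⟩ := hf.exists_eq_const_mul_phiM21 hτ h0
  rw [hK, mul_eq_zero, or_iff_left (phiM21_ne_zero hτ (half_lattice_ne hτ hxy))] at h
  rw [hK, h, zero_mul]

lemma jacobiTheta₂_half (τ : ℂ) : jacobiTheta₂ (1 / 2 + τ / 2) τ = 0 := by
  have h := jacobiTheta₂_add_left' (1 / 2 - τ / 2) τ
  rw [← jacobiTheta₂_neg_left (1 / 2 - τ / 2), ← jacobiTheta₂_add_left (-(1 / 2 - τ / 2)),
    show -Real.pi * I * (τ + 2 * (1 / 2 - τ / 2)) = -(Real.pi * I) by ring, Complex.exp_neg,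
    Complex.exp_pi_mul_I, show 1 / 2 - τ / 2 + τ = 1 / 2 + τ / 2 by ring,
    show -(1 / 2 - τ / 2) + 1 = 1 / 2 + τ / 2 by ring] at h
  rw [inv_neg, inv_one, neg_one_mul] at h
  exact self_eq_neg.mp h

lemma theta00_zero_ne_zero (hτ : 0 < τ.im) : theta00 τ 0 ≠ 0 := by
  intro h
  obtain ⟨w, hw⟩ := exists_jacobiTheta₂_ne_zero hτ
  have := (isIndexOne_theta00_sq hτ).eq_zero hτ (by simp [h]) (x := 1) (y := 1)
    (.inl odd_one) (by
      simp [theta00_eq, show (τ + 1) / 2 = 1 / 2 + τ / 2 by ring, jacobiTheta₂_half, -one_div]) w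
  rw [theta00_eq] at this
  exact hw (pow_eq_zero_iff two_ne_zero |>.mp this)

lemma theta01_zero_ne_zero (hτ : 0 < τ.im) : theta01 τ 0 ≠ 0 := by
  rw [← theta00_tau_add_one]
  exact theta00_zero_ne_zero (by simpa using hτ)

lemma theta10_zero_ne_zero (hτ : 0 < τ.im) : theta10 τ 0 ≠ 0 := by
  have h := theta01_S hτ 0
  rw [zero_div] at h
  exact right_ne_zero_of_mul (h ▸ theta01_zero_ne_zero (im_neg_one_div_pos hτ))

/-! ### The function `φ_{0,1}` -/

lemma isIndexOne_phi01 (hτ : 0 < τ.im) : IsIndexOne τ (phi01 τ) := by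
  have h := (((isIndexOne_theta00_sq hτ).const_mul (4 / theta00 τ 0 ^ 2)).add
    ((isIndexOne_theta01_sq hτ).const_mul (4 / theta01 τ 0 ^ 2))).add
    ((isIndexOne_theta10_sq hτ).const_mul (4 / theta10 τ 0 ^ 2))
  convert h using 1
  funext z
  simp only [phi01, xi00, xi01, xi10]
  ring

lemma phi01_zero (hτ : 0 < τ.im) : phi01 τ 0 = 12 := by
  simp only [phi01, xi00, xi01, xi10, div_self (theta00_zero_ne_zero hτ),
    div_self (theta01_zero_ne_zero hτ), div_self (theta10_zero_ne_zero hτ)]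
  norm_num

lemma phi01_tau_add_one (τ z : ℂ) : phi01 (τ + 1) z = phi01 τ z := by
  simp only [phi01, xi00, xi01, xi10, theta00_tau_add_one, theta01_tau_add_one,
    theta10_tau_add_one, mul_div_mul_left _ _ (Complex.exp_ne_zero _)]
  ring

lemma phi01_S (hτ : 0 < τ.im) (z : ℂ) :
    phi01 (-1 / τ) (z / τ) = e2 (z ^ 2 / τ) * phi01 τ z := by
  have h00 := theta00_S hτ 0
  have h01 := theta01_S hτ 0
  have h10 := theta10_S hτ 0
  rw [zero_div] at h00 h01 h10
  simp only [phi01, xi00, xi01, xi10, h00, h01, h10, theta00_S hτ, theta01_S hτ, theta10_S hτ,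
    ← thetaFactor_div_sq hτ, mul_div_mul_comm]
  ring

lemma phi01_half (τ : ℂ) : phi01 τ (1 / 2) =
    4 * ((jacobiTheta (τ + 1) / jacobiTheta τ) ^ 2 + (jacobiTheta τ / jacobiTheta (τ + 1)) ^ 2) := by
  have h1 : jacobiTheta (τ + 1) = jacobiTheta₂ (1 / 2) τ := by
    rw [jacobiTheta_eq_jacobiTheta₂, jacobiTheta₂_tau_add_one, zero_add]
  have h2 : jacobiTheta₂ (1 / 2 + 1 / 2) τ = jacobiTheta₂ 0 τ := by
    rw [add_halves, ← zero_add 1, jacobiTheta₂_add_left]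
  simp only [phi01, xi00, xi01, xi10, theta00_eq, theta01_eq, theta10_eq, jacobiTheta₂_half, h1,
    jacobiTheta_eq_jacobiTheta₂, h2, zero_add]
  ring

/-- Index-one functions are spanned by `φ_{0,1}` and `φ_{-2,1}`. -/
lemma IsIndexOne.eq_phi01_add_phiM21 (hτ : 0 < τ.im) (hf : IsIndexOne τ f) (z : ℂ) :
    12 * f z = f 0 * phi01 τ z +
      (12 * f (1 / 2) - f 0 * phi01 τ (1 / 2)) / phiM21 τ (1 / 2) * phiM21 τ z := by
  have hg := (hf.const_mul 12).add ((isIndexOne_phi01 hτ).const_mul (-f 0))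
  obtain ⟨K, hK⟩ := hg.exists_eq_const_mul_phiM21 hτ (by simp only [phi01_zero hτ]; ring)
  have h0 : phiM21 τ (1 / 2) ≠ 0 := phiM21_ne_zero hτ fun m n ↦ by
    simpa using half_lattice_ne hτ (x := 0) (y := 1) (.inr odd_one) m n
  have h1 := hK (1 / 2)
  have h2 := hK z
  rw [show 12 * f (1 / 2) - f 0 * phi01 τ (1 / 2) = K * phiM21 τ (1 / 2) by
    linear_combination h1, mul_div_cancel_right₀ _ h0]
  linear_combination h2

end thetas

section summands

variable {τ : ℂ}

/-- The index-one theta series `∑ q^(l²) ζ^(2l)`. -/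
def thetaSq (τ z : ℂ) : ℂ := jacobiTheta₂ (2 * z) (2 * τ)

lemma isIndexOne_thetaSq (hτ : 0 < τ.im) : IsIndexOne τ (thetaSq τ) where
  differentiable := by
    have h : Differentiable ℂ (jacobiTheta₂ · (2 * τ)) :=
      fun z ↦ differentiableAt_jacobiTheta₂_fst z (by simpa using hτ)
    exact h.comp (differentiable_id.const_mul _)
  neg z := by rw [thetaSq, mul_neg, jacobiTheta₂_neg_left, thetaSq]
  add_one z := by
    rw [thetaSq, show 2 * (z + 1) = 2 * z + 1 + 1 by ring, jacobiTheta₂_add_left,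
      jacobiTheta₂_add_left, thetaSq]
  add_tau z := by
    rw [thetaSq, mul_add, jacobiTheta₂_add_left', thetaSq, e2]
    ring_nf

lemma thetaSq_add_int (τ z : ℂ) (n : ℤ) : thetaSq (τ + n) z = thetaSq τ z := by
  have h : Function.Periodic (jacobiTheta₂ (2 * z)) 2 := fun τ ↦ jacobiTheta₂_add_right _ _
  rw [thetaSq, mul_add, mul_comm 2 (n : ℂ)]
  exact h.int_mul n _

lemma bezout_spec {c d : ℤ} (h : IsCoprime c d) : (bezout c d).1 * d - (bezout c d).2 * c = 1 := by
  have h' : ∃ ab : ℤ × ℤ, ab.1 * d - ab.2 * c = 1 := by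
    obtain ⟨u, v, huv⟩ := h
    exact ⟨(v, -u), by linear_combination huv⟩
  rw [bezout, dif_pos h']
  exact h'.choose_spec

lemma isCoprime_of_det {a b c d : ℤ} (h : a * d - b * c = 1) : IsCoprime c d :=
  ⟨-b, a, by linear_combination h⟩

/-- The summands of `E_{6,1}` are slash translates of `thetaSq`. -/
lemma EisJSummand_eq (hτ : 0 < τ.im) {a b c d : ℤ} (h : a * d - b * c = 1) (z : ℂ) :
    EisJSummand 6 1 τ z c d = (c * τ + d) ^ (-6 : ℤ) *
      (e2 (-(c * z ^ 2 / (c * τ + d))) *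
        thetaSq ((a * τ + b) / (c * τ + d)) (z / (c * τ + d))) := by
  have hj := denom_ne_zero' hτ h
  have hb := bezout_spec (isCoprime_of_det h)
  rw [EisJSummand]
  set a' := (bezout c d).1
  set b' := (bezout c d).2
  have ha : a' - a = (a * b' - a' * b) * c := by
    linear_combination -a' * h + a * hb
  have hb' : b' - b = (a * b' - a' * b) * d := by
    linear_combination -b' * h + b * hb
  have hτ' : (a' * τ + b') / (c * τ + d) =
      (a * τ + b) / (c * τ + d) + ((a * b' - a' * b : ℤ) : ℂ) := by
    have ha'' := congrArg (Int.cast : ℤ → ℂ) ha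
    have hb'' := congrArg (Int.cast : ℤ → ℂ) hb'
    rw [div_add' _ _ _ hj]
    congr 1
    push_cast at ha'' hb'' ⊢
    linear_combination τ * ha'' + hb''
  rw [← thetaSq_add_int _ _ (a * b' - a' * b), ← hτ', thetaSq, jacobiTheta₂,
    ← tsum_mul_left (a := e2 _)]
  congr 1
  refine tsum_congr fun l ↦ ?_
  rw [jacobiTheta₂_term, e2, e2, ← Complex.exp_add]
  congr 1
  push_cast
  ring

lemma isIndexOne_EisJSummand (hτ : 0 < τ.im) {c d : ℤ} (h : IsCoprime c d) :
    IsIndexOne τ fun z ↦ EisJSummand 6 1 τ z c d := by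
  have hb := bezout_spec h
  simp_rw [EisJSummand_eq hτ hb]
  exact (IsIndexOne.slash hτ hb (isIndexOne_thetaSq (im_moebius_pos hτ hb))).const_mul _

lemma EisJSummand_S (hτ : 0 < τ.im) {c d : ℤ} (h : IsCoprime c d) (z : ℂ) :
    EisJSummand 6 1 (-1 / τ) (z / τ) c d =
      τ ^ 6 * e2 (z ^ 2 / τ) * EisJSummand 6 1 τ z d (-c) := by
  have h0 := ne_zero_of_im_pos hτ
  have hb := bezout_spec h
  set a := (bezout c d).1
  set b := (bezout c d).2
  have hb' : b * -c - -a * d = 1 := by linear_combination hb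
  have hj := denom_ne_zero' hτ hb'
  rw [EisJSummand_eq (im_neg_one_div_pos hτ) hb, EisJSummand_eq hτ hb']
  push_cast at hj ⊢
  have e1 : (c * (-1 / τ) + d : ℂ) = (d * τ + -c) / τ := by field_simp; ring
  have e2' : (a * (-1 / τ) + b : ℂ) = (b * τ + -a) / τ := by field_simp; ring
  have e3 : -(c * (z / τ) ^ 2 / ((d * τ + -c) / τ)) =
      z ^ 2 / τ + -(d * z ^ 2 / (d * τ + -c)) := by
    set j : ℂ := d * τ + -c with hjd
    field_simp
    linear_combination -z ^ 2 * hjd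
  have e4 : ((d * τ + -c) / τ) ^ (-6 : ℤ) = τ ^ 6 * (d * τ + -c) ^ (-6 : ℤ) := by
    simp only [zpow_neg, div_zpow, inv_div]
    rw [div_eq_mul_inv]
    norm_cast
  rw [e1, e2', e3, e4, div_div_div_cancel_right₀ h0, div_div_div_cancel_right₀ h0, e2_add]
  ring

lemma EisJSummand_T (hτ : 0 < τ.im) {c d : ℤ} (h : IsCoprime c d) (z : ℂ) :
    EisJSummand 6 1 (τ + 1) z c d = EisJSummand 6 1 τ z c (c + d) := by
  have hb := bezout_spec h
  set a := (bezout c d).1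
  set b := (bezout c d).2
  have hb' : a * (c + d) - (a + b) * c = 1 := by linear_combination hb
  rw [EisJSummand_eq (by simpa using hτ) hb, EisJSummand_eq hτ hb']
  push_cast
  ring_nf

lemma EisJ_S (hτ : 0 < τ.im) (z : ℂ) :
    EisJ 6 1 (-1 / τ) (z / τ) = τ ^ 6 * e2 (z ^ 2 / τ) * EisJ 6 1 τ z := by
  let e : {p : ℤ × ℤ // IsCoprime p.1 p.2} ≃ {p : ℤ × ℤ // IsCoprime p.1 p.2} :=
    { toFun p := ⟨(p.1.2, -p.1.1), p.2.symm.neg_right⟩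
      invFun p := ⟨(-p.1.2, p.1.1), p.2.symm.neg_left⟩
      left_inv p := by simp
      right_inv p := by simp }
  rw [EisJ, EisJ, ← e.tsum_eq fun p ↦ EisJSummand 6 1 τ z p.1.1 p.1.2, mul_left_comm,
    ← tsum_mul_left (a := τ ^ 6 * _)]
  congr 1
  exact tsum_congr fun p ↦ EisJSummand_S hτ p.2 z

lemma EisJ_T (hτ : 0 < τ.im) (z : ℂ) : EisJ 6 1 (τ + 1) z = EisJ 6 1 τ z := by
  let e : {p : ℤ × ℤ // IsCoprime p.1 p.2} ≃ {p : ℤ × ℤ // IsCoprime p.1 p.2} :=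
    { toFun p := ⟨(p.1.1, p.1.1 + p.1.2), by
        simpa [add_comm] using (IsCoprime.add_mul_left_right_iff (z := 1)).mpr p.2⟩
      invFun p := ⟨(p.1.1, p.1.2 - p.1.1), by
        simpa [sub_eq_add_neg] using (IsCoprime.add_mul_left_right_iff (z := -1)).mpr p.2⟩
      left_inv p := by simp
      right_inv p := by simp }
  rw [EisJ, EisJ, ← e.tsum_eq fun p ↦ EisJSummand 6 1 τ z p.1.1 p.1.2]
  congr 1
  exact tsum_congr fun p ↦ EisJSummand_T hτ p.2 z

/-! ### Bounds for the summands -/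

lemma summable_three_div_one_add_sq : Summable fun l : ℤ ↦ 3 / (1 + (l : ℝ) ^ 2) := by
  have h : Summable fun l : ℤ ↦ 1 / (l : ℝ) ^ 2 := by
    simpa using Real.summable_one_div_int_pow.mpr (by norm_num : 1 < 2)
  refine .of_norm_bounded_eventually (h.mul_left 3) ?_
  filter_upwards [(Set.finite_singleton (0 : ℤ)).compl_mem_cofinite] with l hl
  have hl' : (l : ℝ) ≠ 0 := Int.cast_ne_zero.mpr hl
  rw [Real.norm_of_nonneg (by positivity), mul_one_div]
  gcongr
  linarith

lemma exp_neg_mul_sq_le {t : ℝ} (ht : 0 < t) (v : ℝ) :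
    Real.exp (-(2 * Real.pi * (t * v ^ 2))) ≤ (1 + 1 / t) * (1 / (1 + v ^ 2)) := by
  have h1 : 1 + t * v ^ 2 ≤ Real.exp (2 * Real.pi * (t * v ^ 2)) := by
    have h2 := Real.add_one_le_exp (2 * Real.pi * (t * v ^ 2))
    have h3 : 0 ≤ t * v ^ 2 := by positivity
    nlinarith [Real.pi_gt_three]
  have h4 : 0 < 1 + t * v ^ 2 := by positivity
  calc _ ≤ (1 + t * v ^ 2)⁻¹ := by rw [Real.exp_neg]; gcongr
    _ ≤ _ := by
      rw [mul_one_div, inv_eq_one_div, div_le_div_iff₀ h4 (by positivity)]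
      have : (1 + 1 / t) * (1 + t * v ^ 2) = 1 + t * v ^ 2 + 1 / t + v ^ 2 := by field_simp; ring
      rw [this]
      have : 0 < 1 / t := by positivity
      nlinarith [mul_nonneg ht.le (sq_nonneg v)]

lemma one_div_one_add_sub_sq_le (l : ℤ) {f : ℝ} (hf0 : 0 ≤ f) (hf1 : f ≤ 1) :
    1 / (1 + (l - f) ^ 2) ≤ 3 / (1 + (l : ℝ) ^ 2) := by
  rw [div_le_div_iff₀ (by positivity) (by positivity)]
  nlinarith [sq_nonneg ((l : ℝ) - 2 * f)]

/-- Gaussian sums over `ℤ`, bounded uniformly in the centre. -/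
lemma tsum_exp_neg_mul_sub_sq_le {t : ℝ} (ht : 0 < t) (u : ℝ) :
    Summable (fun l : ℤ ↦ Real.exp (-(2 * Real.pi * (t * (l - u) ^ 2)))) ∧
    ∑' l : ℤ, Real.exp (-(2 * Real.pi * (t * (l - u) ^ 2))) ≤
      (1 + 1 / t) * ∑' l : ℤ, 3 / (1 + (l : ℝ) ^ 2) := by
  have hb (l : ℤ) : Real.exp (-(2 * Real.pi * (t * ((l + ⌊u⌋ : ℤ) - u) ^ 2))) ≤
      (1 + 1 / t) * (3 / (1 + (l : ℝ) ^ 2)) := by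
    refine (exp_neg_mul_sq_le ht _).trans (mul_le_mul_of_nonneg_left ?_ (by positivity))
    have : ((l + ⌊u⌋ : ℤ) : ℝ) - u = l - Int.fract u := by rw [Int.fract]; push_cast; ring
    rw [this]
    exact one_div_one_add_sub_sq_le l (Int.fract_nonneg _) (Int.fract_lt_one _).le
  have hs := summable_three_div_one_add_sq.mul_left (1 + 1 / t)
  have hs' := Summable.of_nonneg_of_le (fun _ ↦ (Real.exp_pos _).le) hb hs
  refine ⟨(Equiv.addRight ⌊u⌋).summable_iff.mp hs', ?_⟩
  rw [← (Equiv.addRight ⌊u⌋).tsum_eq, ← tsum_mul_left]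
  exact hs'.tsum_le_tsum hb hs

lemma norm_EisJSummand_le (hτ : 0 < τ.im) {c d : ℤ} (h : IsCoprime c d) (x : ℝ) :
    ‖EisJSummand 6 1 τ x c d‖ ≤ (∑' l : ℤ, 3 / (1 + (l : ℝ) ^ 2)) *
      ((1 + ‖c * τ + d‖ ^ 2 / τ.im) / ‖c * τ + d‖ ^ 6) := by
  have hb := bezout_spec h
  set a := (bezout c d).1 with ha
  set b := (bezout c d).2 with hb'
  have hj := denom_ne_zero' hτ hb
  have hN := Complex.normSq_pos.mpr hj
  have hdet : (a * d - b * c : ℝ) = 1 := by exact_mod_cast hb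
  set t := τ.im / Complex.normSq (c * τ + d) with ht
  have htpos : 0 < t := by positivity
  have him (l : ℤ) : ((1 : ℕ) * ((l : ℂ) ^ 2 * (a * τ + b) / (c * τ + d) +
      2 * l * x / (c * τ + d) - c * x ^ 2 / (c * τ + d))).im = t * (l - c * x) ^ 2 := by
    rw [← add_div, ← sub_div, Nat.cast_one, one_mul, Complex.div_im, ← sub_div, ht,
      div_mul_eq_mul_div]
    congr 1
    simp only [pow_two]
    simp
    linear_combination τ.im * l ^ 2 * hdet
  obtain ⟨hs, hle⟩ := tsum_exp_neg_mul_sub_sq_le htpos (c * x)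
  rw [EisJSummand, norm_mul, norm_zpow]
  have h1 : ‖∑' l : ℤ, e2 ((1 : ℕ) * ((l : ℂ) ^ 2 * (a * τ + b) / (c * τ + d) +
      2 * l * x / (c * τ + d) - c * x ^ 2 / (c * τ + d)))‖ ≤
      (1 + 1 / t) * ∑' l : ℤ, 3 / (1 + (l : ℝ) ^ 2) := by
    have hn (l : ℤ) := (norm_e2 ((1 : ℕ) * ((l : ℂ) ^ 2 * (a * τ + b) / (c * τ + d) +
      2 * l * x / (c * τ + d) - c * x ^ 2 / (c * τ + d)))).trans (by rw [him])
    refine (norm_tsum_le_tsum_norm ?_).trans ?_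
    · simpa only [hn] using hs
    · simpa only [hn] using hle
  refine (mul_le_mul_of_nonneg_left h1 (by positivity)).trans (le_of_eq ?_)
  rw [ht, Complex.normSq_eq_norm_sq, one_div_div, Nat.cast_ofNat, zpow_neg]
  rw [show ‖c * τ + d‖ ^ (6 : ℤ) = ‖c * τ + d‖ ^ 6 by norm_cast]
  ring

end summands

section strips

open EisensteinSeries

lemma summable_inv_norm_pow {k : ℕ} (hk : 2 < k) : Summable fun x : Fin 2 → ℤ ↦ (‖x‖ ^ k)⁻¹ := by
  refine (summable_one_div_norm_rpow (k := k) (by exact_mod_cast hk)).congr fun x ↦ ?_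
  rw [Real.rpow_neg (norm_nonneg _), Real.rpow_natCast]

/-- The summands of `E_{6,1}` at real `z` are dominated by a summable family, uniformly on
vertical strips. -/
lemma exists_summable_bound_EisJSummand (A : ℝ) {B : ℝ} (hB : 0 < B) :
    ∃ u : {p : ℤ × ℤ // IsCoprime p.1 p.2} → ℝ, Summable u ∧
      ∀ p τ (x : ℝ), |τ.re| ≤ A → B ≤ τ.im → ‖EisJSummand 6 1 τ x p.1.1 p.1.2‖ ≤ u p := by
  set R := r ⟨⟨A, B⟩, hB⟩
  have hR : 0 < R := r_pos _
  set C := ∑' l : ℤ, 3 / (1 + (l : ℝ) ^ 2)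
  have hC : 0 ≤ C := tsum_nonneg fun l ↦ by positivity
  let v : {p : ℤ × ℤ // IsCoprime p.1 p.2} → Fin 2 → ℤ := fun p ↦ ![p.1.1, p.1.2]
  have hv : Function.Injective v := fun p p' h ↦
    Subtype.ext (Prod.ext (congrFun h 0) (congrFun h 1))
  refine ⟨fun p ↦ C * ((R ^ 6)⁻¹ * (‖v p‖ ^ 6)⁻¹ + B⁻¹ * (R ^ 4)⁻¹ * (‖v p‖ ^ 4)⁻¹), ?_, ?_⟩
  · exact ((((summable_inv_norm_pow (by norm_num)).comp_injective hv).mul_left _).add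
      (((summable_inv_norm_pow (by norm_num)).comp_injective hv).mul_left _)).mul_left _
  · intro p τ x hA hB'
    have hτ : 0 < τ.im := hB.trans_le hB'
    have hv0 : v p ≠ 0 := by
      intro h
      have h0 : p.1.1 = 0 := congrFun h 0
      have h1 : p.1.2 = 0 := congrFun h 1
      obtain ⟨a, b, hab⟩ := p.2
      simp [h0, h1] at hab
    have hN : R * ‖v p‖ ≤ ‖(p.1.1 : ℂ) * τ + p.1.2‖ := by
      have h := r_mul_max_le ⟨τ, hτ⟩ hv0
      exact (mul_le_mul_of_nonneg_right (r_lower_bound_on_verticalStrip ⟨τ, hτ⟩ hB ⟨hA, hB'⟩)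
        (norm_nonneg _)).trans h
    have hM : 0 < R * ‖v p‖ := mul_pos hR (norm_pos_iff.2 hv0)
    refine (norm_EisJSummand_le hτ p.2 x).trans (mul_le_mul_of_nonneg_left ?_ hC)
    set N := ‖(p.1.1 : ℂ) * τ + p.1.2‖
    have hN0 : 0 < N := hM.trans_le hN
    have h : (1 + N ^ 2 / τ.im) / N ^ 6 = (N ^ 6)⁻¹ + τ.im⁻¹ * (N ^ 4)⁻¹ := by
      field_simp
    rw [h, mul_assoc, ← mul_inv (R ^ 6), ← mul_inv (R ^ 4), ← mul_pow, ← mul_pow]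
    gcongr

variable {τ : ℂ}

lemma summable_EisJSummand (hτ : 0 < τ.im) (x : ℝ) :
    Summable fun p : {p : ℤ × ℤ // IsCoprime p.1 p.2} ↦ EisJSummand 6 1 τ x p.1.1 p.1.2 := by
  obtain ⟨u, hu, h⟩ := exists_summable_bound_EisJSummand |τ.re| hτ
  exact .of_norm_bounded hu fun p ↦ h p τ x le_rfl le_rfl

lemma differentiableAt_thetaSq {f : ℂ → ℂ} {g : ℂ → ℂ} (hτ : 0 < (g τ).im)
    (hf : DifferentiableAt ℂ f τ) (hg : DifferentiableAt ℂ g τ) :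
    DifferentiableAt ℂ (fun t ↦ thetaSq (g t) (f t)) τ := by
  have h := (hasFDerivAt_jacobiTheta₂ (2 * f τ) (τ := 2 * g τ) (by simpa using hτ)).differentiableAt
  exact h.comp τ ((hf.const_mul 2).prodMk (hg.const_mul 2))

lemma differentiableAt_EisJSummand (hτ : 0 < τ.im) {c d : ℤ} (h : IsCoprime c d) (z : ℂ) :
    DifferentiableAt ℂ (fun t ↦ EisJSummand 6 1 t z c d) τ := by
  have hb := bezout_spec h
  have hj := denom_ne_zero' hτ hb
  have heq : (fun t ↦ EisJSummand 6 1 t z c d) =ᶠ[𝓝 τ] fun t ↦ _ :=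
    (isOpen_lt continuous_const continuous_im).eventually_mem hτ |>.mono
      fun t ht ↦ EisJSummand_eq ht hb z
  refine DifferentiableAt.congr_of_eventuallyEq ?_ heq
  have hden : DifferentiableAt ℂ (fun t : ℂ ↦ (c : ℂ) * t + d) τ := by fun_prop
  have hden' {w : ℂ → ℂ} (hw : DifferentiableAt ℂ w τ) :
      DifferentiableAt ℂ (fun t ↦ w t / (c * t + d)) τ := hw.fun_div hden hj
  refine (hden.zpow (.inl hj)).mul (.mul ?_ ?_)
  · exact (differentiable_e2 _).comp τ (hden' (differentiableAt_const _)).neg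
  · exact differentiableAt_thetaSq (im_moebius_pos hτ hb) (hden' (differentiableAt_const _))
      (hden' (by fun_prop))

lemma differentiableAt_EisJ (hτ : 0 < τ.im) (x : ℝ) :
    DifferentiableAt ℂ (fun t ↦ EisJ 6 1 t x) τ := by
  obtain ⟨u, hu, hle⟩ := exists_summable_bound_EisJSummand (|τ.re| + 1) (half_pos hτ)
  let U : Set ℂ := {t | |t.re| < |τ.re| + 1} ∩ {t | τ.im / 2 < t.im}
  have hU : IsOpen U := (isOpen_lt (by fun_prop) continuous_const).inter
    (isOpen_lt continuous_const continuous_im)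
  have hτU : τ ∈ U := ⟨lt_add_one |τ.re|, half_lt_self hτ⟩
  refine ((differentiableOn_tsum_of_summable_norm hu (fun p t ht ↦ ?_) hU
    fun p t ht ↦ ?_).differentiableAt (hU.mem_nhds hτU)).const_mul _
  · exact (differentiableAt_EisJSummand ((half_pos hτ).trans ht.2) p.2 _).differentiableWithinAt
  · exact hle p t x ht.1.le ht.2.le

/-- `E_{6,1}` in terms of its values at `0` and `1/2`. -/
lemma EisJ_eq (hτ : 0 < τ.im) (z : ℂ) :
    12 * EisJ 6 1 τ z = EisJ 6 1 τ 0 * phi01 τ z +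
      (12 * EisJ 6 1 τ (1 / 2) - EisJ 6 1 τ 0 * phi01 τ (1 / 2)) / phiM21 τ (1 / 2) *
        phiM21 τ z := by
  have h0 := (summable_EisJSummand hτ 0).hasSum
  have h1 := (summable_EisJSummand hτ (1 / 2)).hasSum
  push_cast at h0 h1
  have h := ((h0.mul_right (phi01 τ z)).add (((h1.mul_left 12).sub
    (h0.mul_right (phi01 τ (1 / 2)))).div_const (phiM21 τ (1 / 2)) |>.mul_right (phiM21 τ z)))
  have h' := h.tsum_eq
  rw [tsum_congr fun p : {p : ℤ × ℤ // IsCoprime p.1 p.2} ↦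
    ((isIndexOne_EisJSummand hτ p.2).eq_phi01_add_phiM21 hτ z).symm, tsum_mul_left] at h'
  simp only [EisJ]
  linear_combination (1 / 2) * h'

end strips

section cusp

variable {τ : ℂ}

lemma eventually_comap_im {P : ℂ → Prop} {y : ℝ} (h : ∀ τ : ℂ, y ≤ τ.im → P τ) :
    ∀ᶠ τ in comap im atTop, P τ :=
  (tendsto_comap.eventually (eventually_ge_atTop y)).mono h

lemma tendsto_comap_im_of_strip {F : ℂ → ℂ} {l : ℂ}
    (hF : ∀ τ : ℂ, 0 < τ.im → F (τ + 1) = F τ)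
    (h : Tendsto F (comap im atTop ⊓ 𝓟 {τ | |τ.re| ≤ 1}) (𝓝 l)) :
    Tendsto F (comap im atTop) (𝓝 l) := by
  have hper (n : ℤ) : ∀ τ : ℂ, 0 < τ.im → F (τ + n) = F τ := by
    induction n using Int.induction_on with
    | zero => simp
    | succ n ih =>
      intro τ hτ
      rw [Int.cast_add, Int.cast_one, ← add_assoc, hF _ (by simpa using hτ), ih τ hτ]
    | pred n ih =>
      intro τ hτ
      rw [← ih τ hτ, ← hF (τ + _) (by simpa using hτ)]
      push_cast
      ring_nf
  let s : ℂ → ℂ := fun τ ↦ τ + (-⌊τ.re⌋ : ℤ)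
  have hs : Tendsto s (comap im atTop) (comap im atTop ⊓ 𝓟 {τ | |τ.re| ≤ 1}) := by
    refine tendsto_inf.2 ⟨tendsto_comap_iff.2 ?_, tendsto_principal.2 (.of_forall fun τ ↦ ?_)⟩
    · have : im ∘ s = im := by ext τ; simp only [Function.comp_apply, s, add_im, intCast_im, add_zero]
      rw [this]
      exact tendsto_comap
    · have h0 := Int.floor_le τ.re
      have h1 := Int.lt_floor_add_one τ.re
      rw [Set.mem_ofPred_eq, add_re, intCast_re, Int.cast_neg, abs_le]
      constructor <;> linarith
  exact (h.comp hs).congr' (eventually_comap_im (y := 1) fun τ hτ ↦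
    hper _ τ (one_pos.trans_le hτ))

lemma tendsto_comap_im_mul {n : ℝ} (hn : 0 < n) :
    Tendsto (fun τ : ℂ ↦ (n : ℂ) * τ) (comap im atTop) (comap im atTop) := by
  refine tendsto_comap_iff.2 ?_
  have : im ∘ (fun τ : ℂ ↦ (n : ℂ) * τ) = fun τ ↦ n * im τ := by ext; simp
  rw [this]
  exact tendsto_comap.const_mul_atTop hn

lemma tendsto_comap_im_add_one :
    Tendsto (fun τ : ℂ ↦ τ + 1) (comap im atTop) (comap im atTop) := by
  refine tendsto_comap_iff.2 ?_
  have : im ∘ (fun τ : ℂ ↦ τ + 1) = im := by ext; simp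
  rw [this]
  exact tendsto_comap

lemma tendsto_jacobiTheta : Tendsto jacobiTheta (comap im atTop) (𝓝 1) := by
  have h : Tendsto (fun τ : ℂ ↦ Real.exp (-Real.pi * τ.im)) (comap im atTop) (𝓝 0) := by
    refine Real.tendsto_exp_atBot.comp ?_
    exact tendsto_comap.const_mul_atTop_of_neg (neg_neg_of_pos Real.pi_pos)
  simpa using (isBigO_at_im_infty_jacobiTheta_sub_one.trans_tendsto h).add_const 1

lemma thetaSq_of_two_mul_eq_int {x : ℂ} {n : ℤ} (hx : 2 * x = n) (τ : ℂ) :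
    thetaSq τ x = jacobiTheta (2 * τ) := by
  have h : Function.Periodic (jacobiTheta₂ · (2 * τ)) 1 := fun z ↦ jacobiTheta₂_add_left _ _
  have := h.int_mul n 0
  rw [thetaSq, hx, jacobiTheta_eq_jacobiTheta₂, ← this, mul_one, zero_add]

lemma tendsto_EisJSummand_of_ne_zero {c d : ℤ} (h : IsCoprime c d) (hc : c ≠ 0) (x : ℝ) :
    Tendsto (fun τ ↦ EisJSummand 6 1 τ x c d) (comap im atTop) (𝓝 0) := by
  set C := ∑' l : ℤ, 3 / (1 + (l : ℝ) ^ 2)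
  have hC : 0 ≤ C := tsum_nonneg fun l ↦ by positivity
  have h0 : Tendsto (fun τ : ℂ ↦ C * (2 * τ.im⁻¹)) (comap im atTop) (𝓝 0) := by
    simpa using ((tendsto_inv_atTop_zero.comp tendsto_comap).const_mul 2).const_mul C
  refine squeeze_zero_norm' (eventually_comap_im (y := 1) fun τ hτ ↦ ?_) h0
  refine (norm_EisJSummand_le (one_pos.trans_le hτ) h x).trans (mul_le_mul_of_nonneg_left ?_ hC)
  set y := τ.im
  set N := ‖(c : ℂ) * τ + d‖
  have hN : y ≤ N := by
    have h1 : |((c : ℂ) * τ + d).im| ≤ N := abs_im_le_norm _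
    have h2 : (1 : ℝ) ≤ |(c : ℝ)| := by exact_mod_cast Int.one_le_abs hc
    have h3 : ((c : ℂ) * τ + d).im = c * y := by simp [y]
    rw [h3, abs_mul, abs_of_pos (one_pos.trans_le hτ)] at h1
    nlinarith
  have hN1 : 1 ≤ N := hτ.trans hN
  have h1 : 1 + N ^ 2 / y ≤ 2 * N ^ 2 := by
    have := div_le_self (sq_nonneg N) hτ
    nlinarith
  calc (1 + N ^ 2 / y) / N ^ 6 ≤ 2 * N ^ 2 / N ^ 6 := by gcongr
    _ = 2 * (N ^ 4)⁻¹ := by field_simp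
    _ ≤ 2 * y⁻¹ := by
      gcongr
      exact hN.trans (le_self_pow₀ hN1 (by norm_num))

lemma EisJSummand_zero (hτ : 0 < τ.im) {d : ℤ} (h : IsCoprime 0 d) {x : ℂ} {n : ℤ}
    (hx : 2 * x = n) : EisJSummand 6 1 τ x 0 d = jacobiTheta (2 * τ) := by
  have hd : d * d = 1 := by
    rcases Int.isUnit_iff.1 (isCoprime_zero_left.1 h) with rfl | rfl <;> norm_num
  rw [EisJSummand_eq hτ (a := d) (b := 0) (by linarith)]
  rcases Int.isUnit_iff.1 (isCoprime_zero_left.1 h) with rfl | rfl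
  · simp [e2_zero, thetaSq_of_two_mul_eq_int hx]
  · have : 2 * (-x) = ((-n : ℤ) : ℂ) := by push_cast; linear_combination -hx
    simp [e2_zero, div_neg, thetaSq_of_two_mul_eq_int this, Even.neg_pow (by decide : Even 6)]

lemma tendsto_EisJ {x : ℝ} {n : ℤ} (hx : 2 * x = n) :
    Tendsto (fun τ ↦ EisJ 6 1 τ x) (comap im atTop) (𝓝 1) := by
  refine tendsto_comap_im_of_strip (fun τ hτ ↦ EisJ_T hτ _) ?_
  obtain ⟨u, hu, hle⟩ := exists_summable_bound_EisJSummand 1 one_pos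
  have key := tendsto_tsum_of_dominated_convergence
    (𝓕 := comap im atTop ⊓ 𝓟 {τ : ℂ | |τ.re| ≤ 1})
    (f := fun τ (p : {p : ℤ × ℤ // IsCoprime p.1 p.2}) ↦ EisJSummand 6 1 τ x p.1.1 p.1.2)
    (g := fun p ↦ if p.1.1 = 0 then 1 else 0) hu (fun p ↦ ?_) ?_
  · have hsum : ∑' p : {p : ℤ × ℤ // IsCoprime p.1 p.2}, (if p.1.1 = 0 then (1 : ℂ) else 0) = 2 := by
      rw [tsum_eq_sum (s := {⟨(0, 1), isCoprime_one_right⟩,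
        ⟨(0, -1), isCoprime_one_right.neg_right⟩})]
      · rw [Finset.sum_pair (by simp)]
        norm_num
      · rintro ⟨⟨c, d⟩, h⟩ hp
        rw [if_neg]
        rintro rfl
        apply hp
        rcases Int.isUnit_iff.1 (isCoprime_zero_left.1 h) with rfl | rfl <;> simp
    rw [hsum] at key
    have h := key.const_mul (1 / 2)
    rwa [show (1 / 2 : ℂ) * 2 = 1 by norm_num] at h
  · refine Tendsto.mono_left ?_ inf_le_left
    obtain ⟨⟨c, d⟩, h⟩ := p
    dsimp only
    split_ifs with hc
    · subst hc
      refine (tendsto_jacobiTheta.comp (by simpa using tendsto_comap_im_mul two_pos)).congr'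
        (eventually_comap_im (y := 1) fun τ hτ ↦ ?_)
      exact (EisJSummand_zero (one_pos.trans_le hτ) h (by exact_mod_cast hx)).symm
    · exact tendsto_EisJSummand_of_ne_zero h hc x
  · refine eventually_inf_principal.2 (eventually_comap_im (y := 1) fun τ hτ hre p ↦ ?_)
    exact hle p τ x hre hτ

lemma jacobiTheta_ne_zero (hτ : 0 < τ.im) : jacobiTheta τ ≠ 0 := by
  rw [jacobiTheta_eq_jacobiTheta₂, ← theta00_eq]
  exact theta00_zero_ne_zero hτ

lemma tendsto_phi01_half : Tendsto (fun τ ↦ phi01 τ (1 / 2)) (comap im atTop) (𝓝 8) := by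
  have h := tendsto_jacobiTheta
  have h' := h.comp tendsto_comap_im_add_one
  have := (((h'.div h one_ne_zero).pow 2).add ((h.div h' one_ne_zero).pow 2)).const_mul 4
  simp_rw [phi01_half]
  rwa [show (4 : ℂ) * ((1 / 1) ^ 2 + (1 / 1) ^ 2) = 8 by norm_num] at this

lemma differentiableAt_phi01_half (hτ : 0 < τ.im) :
    DifferentiableAt ℂ (fun t ↦ phi01 t (1 / 2)) τ := by
  have hτ' : 0 < (τ + 1).im := by simpa using hτ
  have h := differentiableAt_jacobiTheta hτ
  have h' : DifferentiableAt ℂ (fun t ↦ jacobiTheta (t + 1)) τ :=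
    (differentiableAt_jacobiTheta hτ').comp τ (differentiableAt_id.add_const 1)
  simp_rw [phi01_half]
  exact (((h'.fun_div h (jacobiTheta_ne_zero hτ)).fun_pow 2).fun_add
    ((h.fun_div h' (jacobiTheta_ne_zero hτ')).fun_pow 2)).const_mul 4

lemma tendsto_qC : Tendsto qC (comap im atTop) (𝓝 0) := by
  rw [tendsto_zero_iff_norm_tendsto_zero]
  simp_rw [qC, norm_e2]
  refine Real.tendsto_exp_neg_atTop_nhds_zero.comp ?_
  exact tendsto_comap.const_mul_atTop Real.two_pi_pos

lemma differentiableAt_qPoch_one {q : ℂ} (hq : ‖q‖ < 1) :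
    DifferentiableAt ℂ (fun q ↦ qPoch q 1) q :=
  differentiableOn_qPoch_one.differentiableAt (Metric.isOpen_ball.mem_nhds (by simpa using hq))

lemma tendsto_phiM21_half : Tendsto (fun τ ↦ phiM21 τ (1 / 2)) (comap im atTop) (𝓝 (-4)) := by
  have h : Tendsto (fun q ↦ qPoch q 1) (𝓝 0) (𝓝 1) := by
    simpa [ContinuousAt, qPoch] using (differentiableAt_qPoch_one (q := 0) (by simp)).continuousAt
  have h1 := h.comp tendsto_qC
  have h2 := h.comp (by simpa using tendsto_qC.pow 2)
  have := ((h2.div (h1.pow 2) (by norm_num)).pow 4).const_mul (-4)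
  rw [show (-4 : ℂ) * (1 / 1 ^ 2) ^ 4 = -4 by norm_num] at this
  exact this.congr' (eventually_comap_im (y := 1) fun τ hτ ↦
    (phiM21_half (one_pos.trans_le hτ)).symm)

lemma differentiableAt_phiM21_half (hτ : 0 < τ.im) :
    DifferentiableAt ℂ (fun t ↦ phiM21 t (1 / 2)) τ := by
  have hq := norm_qC_lt_one hτ
  have hd : DifferentiableAt ℂ qC τ := differentiable_e2 τ
  have h1 : DifferentiableAt ℂ (fun t ↦ qPoch (qC t) 1) τ :=
    (differentiableAt_qPoch_one hq).comp τ hd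
  have hq2 : ‖qC τ ^ 2‖ < 1 := by
    rw [norm_pow]
    exact pow_lt_one₀ (norm_nonneg _) hq two_ne_zero
  have h2 : DifferentiableAt ℂ (fun t ↦ qPoch (qC t ^ 2) 1) τ :=
    (differentiableAt_qPoch_one hq2).comp (f := fun t ↦ qC t ^ 2) τ (hd.fun_pow 2)
  refine DifferentiableAt.congr_of_eventuallyEq (((h2.fun_div (h1.fun_pow 2)
    (pow_ne_zero 2 (qPoch_one_ne_zero hτ))).fun_pow 4).const_mul (-4)) ?_
  exact (isOpen_lt continuous_const continuous_im).eventually_mem hτ |>.mono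
    fun t ht ↦ phiM21_half ht

end cusp

section modular

open UpperHalfPlane hiding I
open ModularForm EisensteinSeries MatrixGroups

variable {τ : ℂ}

/-- Holomorphic functions on `ℍ` transforming like level one modular forms of weight `k`. -/
structure IsWeaklyModular (k : ℤ) (F : ℂ → ℂ) : Prop where
  differentiableAt : ∀ {τ : ℂ}, 0 < τ.im → DifferentiableAt ℂ F τ
  add_one : ∀ {τ : ℂ}, 0 < τ.im → F (τ + 1) = F τ
  neg_one_div : ∀ {τ : ℂ}, 0 < τ.im → F (-1 / τ) = τ ^ k * F τ

namespace IsWeaklyModular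

variable {k l : ℤ} {F G : ℂ → ℂ}

lemma add (hF : IsWeaklyModular k F) (hG : IsWeaklyModular k G) :
    IsWeaklyModular k fun τ ↦ F τ + G τ where
  differentiableAt h := (hF.differentiableAt h).fun_add (hG.differentiableAt h)
  add_one h := by simp only [hF.add_one h, hG.add_one h]
  neg_one_div h := by simp only [hF.neg_one_div h, hG.neg_one_div h, mul_add]

lemma sub (hF : IsWeaklyModular k F) (hG : IsWeaklyModular k G) :
    IsWeaklyModular k fun τ ↦ F τ - G τ where
  differentiableAt h := (hF.differentiableAt h).fun_sub (hG.differentiableAt h)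
  add_one h := by simp only [hF.add_one h, hG.add_one h]
  neg_one_div h := by simp only [hF.neg_one_div h, hG.neg_one_div h, mul_sub]

lemma mul (hF : IsWeaklyModular k F) (hG : IsWeaklyModular l G) :
    IsWeaklyModular (k + l) fun τ ↦ F τ * G τ where
  differentiableAt h := (hF.differentiableAt h).fun_mul (hG.differentiableAt h)
  add_one h := by simp only [hF.add_one h, hG.add_one h]
  neg_one_div h := by
    simp only [hF.neg_one_div h, hG.neg_one_div h, zpow_add₀ (ne_zero_of_im_pos h)]
    ring

/-- There are no nonzero level one cusp forms of weight less than twelve. -/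
lemma eq_zero (hF : IsWeaklyModular k F) (hk : k < 12)
    (h : Tendsto F (comap Complex.im atTop) (𝓝 0)) (hτ : 0 < τ.im) : F τ = 0 := by
  let f : ℍ → ℂ := fun z ↦ F z
  have hS : f ∣[k] ModularGroup.S = f := by
    ext z
    rw [SlashInvariantForm.slash_S_apply]
    have h1 := hF.neg_one_div z.im_pos
    have h2 : (-(z : ℂ))⁻¹ = -1 / z := by rw [inv_neg, neg_div, one_div]
    simp only [f, h2, h1]
    rw [mul_right_comm, ← zpow_add₀ z.ne_zero, add_neg_cancel, zpow_zero, one_mul]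
  have hT : f ∣[k] ModularGroup.T = f := by
    ext z
    have hd : denom (ModularGroup.T : SL(2, ℤ)) z = 1 := by
      simp [denom, ModularGroup.coe_T]
    rw [SL_slash_apply, hd, modular_T_smul]
    simp [f, add_comm (1 : ℂ), hF.add_one z.im_pos]
  have hinv := SlashInvariantForm.slash_action_generators_SL2Z hS hT
  let g : CuspForm 𝒮ℒ k :=
    { toFun := f
      slash_action_eq' := by
        rintro _ ⟨γ, rfl⟩
        exact hinv γ
      holo' := by
        rw [UpperHalfPlane.mdifferentiable_iff]
        refine .congr (fun z hz ↦ (hF.differentiableAt hz).differentiableWithinAt) fun z hz ↦ ?_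
        simp [f, ofComplex_apply_of_im_pos hz]
      zero_at_cusps' := by
        intro c hc
        rw [Subgroup.IsArithmetic.isCusp_iff_isCusp_SL2Z] at hc
        rw [OnePoint.isZeroAt_iff_forall_SL2Z hc]
        intro γ _
        rw [hinv]
        exact h.comp tendsto_coe_atImInfty }
  have hg : g = 0 := rank_zero_iff_forall_zero.1 (CuspForm.rank_eq_zero_of_weight_lt_twelve hk) g
  exact congrArg (fun g : CuspForm 𝒮ℒ k ↦ g ⟨τ, hτ⟩) hg

end IsWeaklyModular

lemma Eis_coe {k : ℕ} (hk : 3 ≤ k) (hk2 : Even k) (z : ℍ) : Eis k z = E hk z := by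
  rw [q_expansion_bernoulli hk hk2]
  simp_rw [zpow_natCast]
  rw [tsum_pnat_eq_tsum_succ
    (f := fun n ↦ (ArithmeticFunction.sigma (k - 1) n : ℂ) * cexp (2 * Real.pi * I * z) ^ n)]
  simp [Eis, sigma', ArithmeticFunction.sigma_apply, qC, e2]

lemma Eis_eq {k : ℕ} (hk : 3 ≤ k) (hk2 : Even k) (hτ : 0 < τ.im) :
    Eis k τ = (E hk ∘ ofComplex) τ := by
  rw [Function.comp_apply, ofComplex_apply_of_im_pos hτ, ← Eis_coe hk hk2]

lemma isWeaklyModular_Eis {k : ℕ} (hk : 3 ≤ k) (hk2 : Even k) : IsWeaklyModular k (Eis k) where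
  differentiableAt {τ} hτ := by
    have h := UpperHalfPlane.mdifferentiable_iff.1 (E hk).holo'
    have hn : {z : ℂ | 0 < z.im} ∈ 𝓝 τ := isOpen_upperHalfPlaneSet.mem_nhds hτ
    refine (h.differentiableAt hn).congr_of_eventuallyEq ?_
    filter_upwards [hn] with t ht using Eis_eq hk hk2 ht
  add_one {τ} hτ := by
    simp [Eis, qC, e2_add, e2_one]
  neg_one_div {τ} hτ := by
    have h1 : (⇑(E hk) ∣[(k : ℤ)] ModularGroup.S) = ⇑(E hk) :=
      (E hk).slash_action_eq' _ ⟨ModularGroup.S, rfl⟩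
    have h2 := congrFun h1 ⟨τ, hτ⟩
    rw [SlashInvariantForm.slash_S_apply, ← Eis_coe hk hk2, ← Eis_coe hk hk2] at h2
    have h3 : (-τ)⁻¹ = -1 / τ := by rw [inv_neg, neg_div, one_div]
    simp only [h3] at h2
    rw [← h2, mul_left_comm, ← zpow_add₀ (ne_zero_of_im_pos hτ), add_neg_cancel, zpow_zero, mul_one]

lemma tendsto_Eis {k : ℕ} (hk : 3 ≤ k) (hk2 : Even k) :
    Tendsto (Eis k) (comap Complex.im atTop) (𝓝 1) := by
  have hv : valueAtInfty (E hk) = 1 := by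
    rw [← E_qExpansion_coeff_zero hk hk2]
    exact (qExpansion_coeff_zero one_pos
      (ModularFormClass.analyticAt_cuspFunction_zero _ one_pos one_mem_strictPeriods_SL)
      (SlashInvariantFormClass.periodic_comp_ofComplex _ one_mem_strictPeriods_SL)).symm
  obtain ⟨c, hc, h⟩ := ModularFormClass.exp_decay_sub_atImInfty' (E hk)
  have h0 : Tendsto (fun z : ℍ ↦ Real.exp (-c * z.im)) atImInfty (𝓝 0) :=
    Real.tendsto_exp_atBot.comp
      ((tendsto_comap (f := UpperHalfPlane.im)).const_mul_atTop_of_neg (neg_neg_of_pos hc))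
  have h1 := ((h.trans_tendsto h0).add_const (valueAtInfty (E hk))).comp tendsto_comap_im_ofComplex
  rw [zero_add, hv] at h1
  refine h1.congr' (eventually_comap_im (y := 1) fun τ hτ ↦ ?_)
  rw [Eis_eq hk hk2 (one_pos.trans_le hτ)]
  simp

end modular

section main

variable {τ : ℂ}

lemma phiM21_half_ne_zero (hτ : 0 < τ.im) : phiM21 τ (1 / 2) ≠ 0 :=
  phiM21_ne_zero hτ fun m n ↦ by
    simpa using half_lattice_ne hτ (x := 0) (y := 1) (.inr odd_one) m n

lemma isWeaklyModular_EisJ_zero : IsWeaklyModular 6 fun τ ↦ EisJ 6 1 τ 0 where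
  differentiableAt hτ := by simpa using differentiableAt_EisJ hτ 0
  add_one hτ := EisJ_T hτ 0
  neg_one_div {τ} hτ := by
    have h := EisJ_S hτ 0
    rw [zero_div, zero_pow two_ne_zero, zero_div, e2_zero, mul_one] at h
    exact_mod_cast h

/-- The coefficient of `φ_{-2,1}` in `12 E_{6,1}`. -/
def phiM21Coeff (τ : ℂ) : ℂ :=
  (12 * EisJ 6 1 τ (1 / 2) - EisJ 6 1 τ 0 * phi01 τ (1 / 2)) / phiM21 τ (1 / 2)

lemma phiM21Coeff_mul (hτ : 0 < τ.im) (z : ℂ) :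
    phiM21Coeff τ * phiM21 τ z = 12 * EisJ 6 1 τ z - EisJ 6 1 τ 0 * phi01 τ z := by
  rw [EisJ_eq hτ, phiM21Coeff]
  ring

lemma isWeaklyModular_phiM21Coeff : IsWeaklyModular 8 phiM21Coeff where
  differentiableAt {τ} hτ := by
    have h := differentiableAt_EisJ hτ (1 / 2)
    push_cast at h
    exact ((h.const_mul 12).fun_sub ((isWeaklyModular_EisJ_zero.differentiableAt hτ).fun_mul
      (differentiableAt_phi01_half hτ))).fun_div (differentiableAt_phiM21_half hτ)
      (phiM21_half_ne_zero hτ)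
  add_one {τ} hτ := by
    simp only [phiM21Coeff, EisJ_T hτ, phi01_tau_add_one, phiM21_tau_add_one hτ]
  neg_one_div {τ} hτ := by
    have h0 := isWeaklyModular_EisJ_zero.neg_one_div hτ
    have h := phiM21Coeff_mul (im_neg_one_div_pos hτ) (1 / 2 / τ)
    rw [EisJ_S hτ, phi01_S hτ, phiM21_S hτ, h0] at h
    have h1 := phiM21Coeff_mul hτ (1 / 2)
    have hne := mul_ne_zero (e2_ne_zero ((1 / 2) ^ 2 / τ)) (phiM21_half_ne_zero hτ)
    have hτ0 := ne_zero_of_im_pos hτ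
    apply mul_right_cancel₀ hne
    have h8 : τ ^ (8 : ℤ) = τ ^ (6 : ℤ) * τ ^ (2 : ℤ) := by rw [← zpow_add₀ hτ0]; norm_num
    have h2 : τ ^ (2 : ℤ) * τ ^ (-2 : ℤ) = 1 := by rw [← zpow_add₀ hτ0]; norm_num
    have h6 : τ ^ (6 : ℤ) = τ ^ 6 := by norm_cast
    rw [h8]
    rw [h6] at h ⊢
    linear_combination τ ^ (2 : ℤ) * h - τ ^ 6 * τ ^ (2 : ℤ) * e2 ((1 / 2) ^ 2 / τ) * h1 -
      phiM21Coeff (-1 / τ) * e2 ((1 / 2) ^ 2 / τ) * phiM21 τ (1 / 2) * h2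

lemma tendsto_phiM21Coeff : Tendsto phiM21Coeff (comap im atTop) (𝓝 (-1)) := by
  have h0 := tendsto_EisJ (x := 0) (n := 0) (by simp)
  have h1 := tendsto_EisJ (x := 1 / 2) (n := 1) (by simp)
  push_cast at h0 h1
  have h := ((h1.const_mul 12).sub (h0.mul tendsto_phi01_half)).div tendsto_phiM21_half (by simp)
  rw [show ((12 : ℂ) * 1 - 1 * 8) / -4 = -1 by norm_num] at h
  exact h

lemma EisJ_zero_eq (hτ : 0 < τ.im) : EisJ 6 1 τ 0 = Eis 6 τ := by
  have hE : IsWeaklyModular 6 (Eis 6) := isWeaklyModular_Eis (by norm_num) (by decide)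
  have h0 := tendsto_EisJ (x := 0) (n := 0) (by simp)
  push_cast at h0
  have h := h0.sub (tendsto_Eis (k := 6) (by norm_num) (by decide))
  rw [sub_self] at h
  exact sub_eq_zero.1 ((isWeaklyModular_EisJ_zero.sub hE).eq_zero (by norm_num) h hτ)

lemma phiM21Coeff_eq (hτ : 0 < τ.im) : phiM21Coeff τ = -Eis 4 τ ^ 2 := by
  have hE : IsWeaklyModular 4 (Eis 4) := isWeaklyModular_Eis (by norm_num) (by decide)
  have hl := tendsto_Eis (k := 4) (by norm_num) (by decide)
  have h := tendsto_phiM21Coeff.add (hl.mul hl)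
  rw [mul_one, neg_add_cancel] at h
  have := (isWeaklyModular_phiM21Coeff.add (hE.mul hE)).eq_zero (by norm_num) h hτ
  linear_combination this

end main

end

/-- `12 E_{6,1} = E₆ φ_{0,1} - E₄² φ_{-2,1}` on `ℍ × ℂ`. -/
theorem twelve_E61 (τ z : ℂ) (hτ : 0 < τ.im) :
    12 * EisJ 6 1 τ z = Eis 6 τ * phi01 τ z - Eis 4 τ ^ 2 * phiM21 τ z := by
  have h := phiM21Coeff_mul hτ z
  rw [phiM21Coeff_eq hτ, EisJ_zero_eq hτ] at h
  linear_combination -h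

end JacobiPaper
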